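/- Let 1 ≤ k ≤ d be integers and let M ⊆ ℝ^d be a C^∞ submanifold of dimension k that is nondegenerate. Then the Hausdorff dimension of the set BA_M(ψ_{c(k,d)}) of ψ_{c(k,d)}-badly intrinsically approximable points of M equals k. -/

import Mathlib

open Set Filter Metric MeasureTheory
noncomputable section

/-- A point of `ℝ^d` is *rational* if all of its coordinates are rational numbers. -/
def IsRatPt {d : ℕ} (x : Fin d → ℝ) : Prop := ∀ i, ∃ a : ℚ, x i = (a : ℝ)

/-- The *height* of a rational point `x ∈ ℚ^d ⊆ ℝ^d`: the least positive integer `q`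
with `q • x ∈ ℤ^d`. -/
def ht {d : ℕ} (x : Fin d → ℝ) : ℕ :=
  sInf {q : ℕ | 0 < q ∧ ∀ i, ∃ m : ℤ, (q : ℝ) * x i = (m : ℝ)}

/-- `Ssum k n = [k-1,1] + [k-1,2] + ⋯ + [k-1,n]` where `[n,m] = C(n+m,m)`. -/
def Ssum (k n : ℕ) : ℕ := ∑ j ∈ Finset.Icc 1 n, Nat.choose (k - 1 + j) j

/-- `nkd k d` is the largest `n ≥ 0` with `[k-1,1] + ⋯ + [k-1,n] ≤ d`. -/
def nkd (k d : ℕ) : ℕ := sSup {n : ℕ | Ssum k n ≤ d}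

/-- `mkd k d = d − ([k-1,1] + ⋯ + [k-1,n_{k,d}])`. -/
def mkd (k d : ℕ) : ℕ := d - Ssum k (nkd k d)

/-- `Nkd k d = 1·[k-1,1] + 2·[k-1,2] + ⋯ + n_{k,d}·[k-1,n_{k,d}] + (n_{k,d}+1)·m_{k,d}`. -/
def Nkd (k d : ℕ) : ℕ :=
  (∑ j ∈ Finset.Icc 1 (nkd k d), j * Nat.choose (k - 1 + j) j) + (nkd k d + 1) * mkd k d

/-- The exponent `c(k,d) = (d+1)/N_{k,d}`. -/
def ckd (k d : ℕ) : ℝ := (d + 1) / (Nkd k d)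

/-- Directional derivative operator: `dirD v f x = Df(x)(v)`. -/
def dirD {E F : Type*} [NormedAddCommGroup E] [NormedSpace ℝ E]
    [NormedAddCommGroup F] [NormedSpace ℝ F] (v : E) (f : E → F) : E → F :=
  fun x => fderiv ℝ f x v

/-- Iterated partial derivative `∂^α` with respect to the directions `e i`,
where direction `e i` is applied `α i` times. -/
def multiD {ι : Type*} [Fintype ι] {E F : Type*} [NormedAddCommGroup E] [NormedSpace ℝ E]
    [NormedAddCommGroup F] [NormedSpace ℝ F] (e : ι → E) (α : ι → ℕ) (f : E → F) : E → F :=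
  (Finset.univ : Finset ι).toList.foldr (fun i g => (dirD (e i))^[α i] g) f

/-- The partial derivative `∂^α f` for a multi-index `α ∈ ℕ^k`. -/
def mderiv {k : ℕ} {F : Type*} [NormedAddCommGroup F] [NormedSpace ℝ F]
    (α : Fin k → ℕ) (f : (Fin k → ℝ) → F) : (Fin k → ℝ) → F :=
  multiD (fun i => Pi.single i (1 : ℝ)) α f

/-- `Φ : U → M` is a `C^∞` local parameterization of the `k`-dimensional submanifold
`M ⊆ ℝ^d`: `U` is open, `Φ` is smooth and injective on `U` with everywhere injective
differential, and `Φ` is a homeomorphism of `U` onto a relatively open subset of `M`. -/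
structure IsLocParam (k d : ℕ) (M : Set (Fin d → ℝ)) (U : Set (Fin k → ℝ))
    (Φ : (Fin k → ℝ) → (Fin d → ℝ)) : Prop where
  open_dom : IsOpen U
  smooth : ContDiffOn ℝ (⊤ : ℕ∞) Φ U
  inj : Set.InjOn Φ U
  maps_to : Φ '' U ⊆ M
  immersion : ∀ v ∈ U, Function.Injective (fderiv ℝ Φ v)
  open_map : ∀ s : Set (Fin k → ℝ), IsOpen s →
    ∃ O : Set (Fin d → ℝ), IsOpen O ∧ Φ '' (s ∩ U) = O ∩ M

/-- `M ⊆ ℝ^d` is a `C^∞` submanifold of dimension `k`. -/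
def IsSmoothSubmanifold (k d : ℕ) (M : Set (Fin d → ℝ)) : Prop :=
  ∀ x ∈ M, ∃ (U : Set (Fin k → ℝ)) (Φ : (Fin k → ℝ) → (Fin d → ℝ)),
    IsLocParam k d M U Φ ∧ x ∈ Φ '' U

/-- `x ∈ M` is `D`-nondegenerate: for some local parameterization `Φ` with `Φ v = x`,
the partial derivatives `∂^α Φ(v)`, `0 < |α| ≤ D`, span `ℝ^d`. -/
def IsNondegAt (k d D : ℕ) (M : Set (Fin d → ℝ)) (x : Fin d → ℝ) : Prop :=
  ∃ (U : Set (Fin k → ℝ)) (Φ : (Fin k → ℝ) → (Fin d → ℝ)) (v : Fin k → ℝ),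
    IsLocParam k d M U Φ ∧ v ∈ U ∧ Φ v = x ∧
    Submodule.span ℝ {y : Fin d → ℝ | ∃ α : Fin k → ℕ,
      0 < (∑ j, α j) ∧ (∑ j, α j) ≤ D ∧ y = mderiv α Φ v} = ⊤

/-- `x ∈ M` is nondegenerate if it is `D`-nondegenerate for some `D`. -/
def IsNondeg (k d : ℕ) (M : Set (Fin d → ℝ)) (x : Fin d → ℝ) : Prop :=
  ∃ D : ℕ, IsNondegAt k d D M x

/-- The set `BA_M(ψ_c)` of `ψ_c`-badly intrinsically approximable points of `M`. -/
def BAset {d : ℕ} (M : Set (Fin d → ℝ)) (c : ℝ) : Set (Fin d → ℝ) :=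
  {x ∈ M | ∃ κ > (0 : ℝ), ∀ r : Fin d → ℝ, IsRatPt r → r ∈ M →
    κ * (ht r : ℝ) ^ (-c) ≤ ‖x - r‖}

/-- The set `VWA_M(ψ_c)` of `ψ_c`-very well intrinsically approximable points of `M`. -/
def VWAset {d : ℕ} (M : Set (Fin d → ℝ)) (c : ℝ) : Set (Fin d → ℝ) :=
  {x ∈ M | ∃ ε > (0 : ℝ),
    {r : Fin d → ℝ | IsRatPt r ∧ r ∈ M ∧ ‖x - r‖ ≤ (ht r : ℝ) ^ (-(c + ε))}.Infinite}

/-- `ψ` is a Dirichlet function for intrinsic approximation on `S ⊆ ℝ^m`. -/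
def IsDirichletFn {m : ℕ} (S : Set (Fin m → ℝ)) (ψ : ℝ → ℝ) : Prop :=
  (∀ t : ℝ, 0 < t → 0 < ψ t) ∧
  ∀ x ∈ S, ∃ C > (0 : ℝ), ∃ r : ℕ → (Fin m → ℝ),
    (∀ n, IsRatPt (r n) ∧ r n ∈ S) ∧ Filter.Tendsto r Filter.atTop (nhds x) ∧
    ∀ n, ‖x - r n‖ ≤ C * ψ (ht (r n))

/-- The closed `t`-neighborhood `S^{(t)}` of a set `S`. -/
def cnbhd {E : Type*} [PseudoMetricSpace E] (S : Set E) (t : ℝ) : Set E :=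
  {x | ∃ y ∈ S, dist x y ≤ t}

/-- `x` belongs to the (topological) support of the measure `μ`. -/
def InSupp {k : ℕ} (μ : Measure (Fin k → ℝ)) (x : Fin k → ℝ) : Prop :=
  ∀ ρ > (0 : ℝ), 0 < μ (ball x ρ)

/-- `μ` is absolutely decaying on `U`. -/
def AbsolutelyDecaying {k : ℕ} (μ : Measure (Fin k → ℝ)) (U : Set (Fin k → ℝ)) : Prop :=
  ∃ C > (0 : ℝ), ∃ a > (0 : ℝ), ∀ x, InSupp μ x → ∀ ρ : ℝ, 0 < ρ → ρ ≤ 1 →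
    closedBall x ρ ⊆ U → ∀ ε > (0 : ℝ), ∀ (w : Fin k → ℝ) (b : ℝ), w ≠ 0 →
      μ (cnbhd {y : Fin k → ℝ | ∑ j, w j * y j = b} (ε * ρ) ∩ closedBall x ρ) ≤
        ENNReal.ofReal (C * ε ^ a) * μ (closedBall x ρ)

/-- `μ` is doubling. -/
def IsDoubling {k : ℕ} (μ : Measure (Fin k → ℝ)) : Prop :=
  ∃ C > (0 : ℝ), ∀ x, InSupp μ x → ∀ ρ : ℝ, 0 < ρ → ρ ≤ 1 →
    μ (closedBall x (2 * ρ)) ≤ ENNReal.ofReal C * μ (closedBall x ρ)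

/-- `μ` is absolutely friendly on `U`: absolutely decaying and doubling. -/
def AbsolutelyFriendly {k : ℕ} (μ : Measure (Fin k → ℝ)) (U : Set (Fin k → ℝ)) : Prop :=
  AbsolutelyDecaying μ U ∧ IsDoubling μ

/-- The class `P_D` of polynomials of degree at most `D` whose coefficient of largest
absolute value has absolute value exactly `1`. -/
def IsPD (k D : ℕ) (p : MvPolynomial (Fin k) ℝ) : Prop :=
  p.totalDegree ≤ D ∧ (∀ m, |p.coeff m| ≤ 1) ∧ ∃ m, |p.coeff m| = 1

/-- Partial derivative within a set `s`, in the `i`-th coordinate direction. -/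
def pderivW {k : ℕ} (s : Set (Fin k → ℝ)) (i : Fin k) (f : (Fin k → ℝ) → ℝ) :
    (Fin k → ℝ) → ℝ :=
  fun x => fderivWithin ℝ f s x (Pi.single i 1)

/-- Iterated partial derivative `∂^α f` within a set `s`. -/
def mderivW {k : ℕ} (s : Set (Fin k → ℝ)) (α : Fin k → ℕ) (f : (Fin k → ℝ) → ℝ) :
    (Fin k → ℝ) → ℝ :=
  (List.finRange k).foldr (fun i g => (pderivW s i)^[α i] g) f

/-- The `C^D` norm `‖f‖_{C^D,B}` of `f` on `B`. -/
def CDnorm {k : ℕ} (D : ℕ) (B : Set (Fin k → ℝ)) (f : (Fin k → ℝ) → ℝ) : ℝ :=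
  sSup {y : ℝ | ∃ α : Fin k → ℕ, (∑ j, α j) ≤ D ∧ ∃ x ∈ B, y = |mderivW B α f x|}

/-- Analytic local parameterization. -/
structure IsAnalLocParam (k d : ℕ) (M : Set (Fin d → ℝ)) (U : Set (Fin k → ℝ))
    (Φ : (Fin k → ℝ) → (Fin d → ℝ)) : Prop where
  open_dom : IsOpen U
  analytic : AnalyticOnNhd ℝ Φ U
  inj : Set.InjOn Φ U
  maps_to : Φ '' U ⊆ M
  immersion : ∀ v ∈ U, Function.Injective (fderiv ℝ Φ v)
  open_map : ∀ s : Set (Fin k → ℝ), IsOpen s →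
    ∃ O : Set (Fin d → ℝ), IsOpen O ∧ Φ '' (s ∩ U) = O ∩ M

/-- `M ⊆ ℝ^d` is a real-analytic submanifold of dimension `k`. -/
def IsAnalSubmanifold (k d : ℕ) (M : Set (Fin d → ℝ)) : Prop :=
  ∀ x ∈ M, ∃ (U : Set (Fin k → ℝ)) (Φ : (Fin k → ℝ) → (Fin d → ℝ)),
    IsAnalLocParam k d M U Φ ∧ x ∈ Φ '' U

/-- `D`-nondegeneracy via an analytic local parameterization. -/
def IsAnalNondegAt (k d D : ℕ) (M : Set (Fin d → ℝ)) (x : Fin d → ℝ) : Prop :=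
  ∃ (U : Set (Fin k → ℝ)) (Φ : (Fin k → ℝ) → (Fin d → ℝ)) (v : Fin k → ℝ),
    IsAnalLocParam k d M U Φ ∧ v ∈ U ∧ Φ v = x ∧
    Submodule.span ℝ {y : Fin d → ℝ | ∃ α : Fin k → ℕ,
      0 < (∑ j, α j) ∧ (∑ j, α j) ≤ D ∧ y = mderiv α Φ v} = ⊤

/-- Nondegeneracy via an analytic local parameterization. -/
def IsAnalNondeg (k d : ℕ) (M : Set (Fin d → ℝ)) (x : Fin d → ℝ) : Prop :=
  ∃ D : ℕ, IsAnalNondegAt k d D M x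

open scoped NNReal ENNReal Topology

/-- A Cantor-type construction: if inside every ball of the `n`-th generation one can find `M`
well separated good balls whose radius is smaller by the factor `β`, then the limit set has
Hausdorff dimension at least `s`, provided `M * β ^ s ≥ 1`. -/
lemma exists_cantor_set {E : Type*} [MetricSpace E] [CompleteSpace E] {M : ℕ} (hM : 1 < M)
    {β : ℝ} (hβ0 : 0 < β) (hβ1 : β < 1) {s : ℝ≥0} (hs0 : 0 < s) (hs : 1 ≤ M * β ^ (s : ℝ))
    (x₀ : E) {r : ℝ} (hr : 0 < r) (P : ℕ → E → E → Prop)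
    (step : ∀ (n : ℕ) (x : E), closedBall x (β ^ n * r) ⊆ closedBall x₀ r →
      ∃ f : Fin M → E,
        (∀ i, closedBall (f i) (β ^ (n + 1) * r) ⊆ closedBall x (β ^ n * r) ∧ P n x (f i)) ∧
        ∀ i j, i ≠ j → 4 * (β ^ (n + 1) * r) ≤ dist (f i) (f j)) :
    ∃ A : Set E, (s : ℝ≥0∞) ≤ dimH A ∧ ∀ a ∈ A, ∃ x : ℕ → E, ∀ n,
      a ∈ closedBall (x n) (β ^ n * r) ∧ closedBall (x n) (β ^ n * r) ⊆ closedBall x₀ r ∧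
      P n (x n) (x (n + 1)) := by
  have : Nonempty E := ⟨x₀⟩
  have : NeZero M := ⟨by omega⟩
  choose! f hf hsep using step
  let X : (ℕ → Fin M) → ℕ → E := fun w n => Nat.rec x₀ (fun m y => f m y (w m)) n
  have X0 (w) : X w 0 = x₀ := rfl
  have XS (w) (n) : X w (n + 1) = f n (X w n) (w n) := rfl
  have hpos (n : ℕ) : 0 < β ^ n * r := by positivity
  have hin (w) (n : ℕ) : closedBall (X w n) (β ^ n * r) ⊆ closedBall x₀ r := by
    induction n with
    | zero => simp [X0]
    | succ n ih => rw [XS]; exact ((hf n _ ih (w n)).1).trans ih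
  have hnest (w) (n : ℕ) :
      closedBall (X w (n + 1)) (β ^ (n + 1) * r) ⊆ closedBall (X w n) (β ^ n * r) := by
    rw [XS]; exact (hf n _ (hin w n) (w n)).1
  have hanti (w) : Antitone fun n => closedBall (X w n) (β ^ n * r) :=
    antitone_nat_of_succ_le (hnest w)
  have hcau (w) : CauchySeq (X w) := by
    refine cauchySeq_of_le_geometric β r hβ1 fun n => ?_
    have := hnest w n (mem_closedBall_self (hpos _).le)
    rw [mem_closedBall, dist_comm] at this
    linarith
  choose a ha using fun w => cauchySeq_tendsto_of_complete (hcau w)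
  have hmem (w) (n : ℕ) : a w ∈ closedBall (X w n) (β ^ n * r) := by
    refine isClosed_closedBall.mem_of_tendsto (ha w) ?_
    filter_upwards [eventually_ge_atTop n] with m hm
    exact hanti w hm (mem_closedBall_self (hpos _).le)
  have hagree (w w' : ℕ → Fin M) (n : ℕ) (h : ∀ i < n, w i = w' i) : X w n = X w' n := by
    induction n with
    | zero => rfl
    | succ n ih =>
      rw [XS, XS, ih fun i hi => h i (by omega), h n (by omega)]
  have hdist (w w' : ℕ → Fin M) (n : ℕ) (h : ∀ i < n, w i = w' i) (hn : w n ≠ w' n) :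
      β ^ (n + 1) * r ≤ dist (a w) (a w') := by
    have h1 := hsep n (X w n) (hin w n) (w n) (w' n) hn
    have h2 := hmem w (n + 1)
    have h3 := hmem w' (n + 1)
    rw [XS, mem_closedBall] at h2 h3
    rw [← hagree w w' n h] at h3
    have h4 := dist_triangle4 (f n (X w n) (w n)) (a w) (a w') (f n (X w n) (w' n))
    rw [dist_comm _ (a w)] at h4
    have := hpos (n + 1)
    linarith
  have hfirst (w w' : ℕ → Fin M) (hne : w ≠ w') : ∃ n, (∀ i < n, w i = w' i) ∧ w n ≠ w' n :=
    ⟨PiNat.firstDiff w w', fun i hi => PiNat.apply_eq_of_lt_firstDiff hi,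
      PiNat.apply_firstDiff_ne hne⟩
  have hinj : Function.Injective a := by
    intro w w' h
    by_contra hne
    obtain ⟨n, h1, h2⟩ := hfirst w w' hne
    have := hdist w w' n h1 h2
    rw [h, dist_self] at this
    exact absurd this (not_le.2 (hpos _))
  let π : E → ℝ := fun x => Real.ofDigits (Function.invFun a x)
  have hπ (w) : π (a w) = Real.ofDigits w := by
    simp only [π, Function.leftInverse_invFun hinj w]
  have hC : 0 ≤ (β * r) ^ (-(s : ℝ)) := by positivity
  have hold : HolderOnWith ((β * r) ^ (-(s : ℝ))).toNNReal s π (range a) := by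
    rintro _ ⟨w, rfl⟩ _ ⟨w', rfl⟩
    rcases eq_or_ne w w' with rfl | hne
    · simp
    obtain ⟨n, h1, h2⟩ := hfirst w w' hne
    have h3 := hdist w w' n h1 h2
    have h4 : dist (π (a w)) (π (a w')) ≤ (β * r) ^ (-(s : ℝ)) * dist (a w) (a w') ^ (s : ℝ) := by
      rw [hπ, hπ, Real.dist_eq]
      have h5 := Real.abs_ofDigits_sub_ofDigits_le (x := w) (y := w') (n := n) h1
      refine h5.trans ?_
      rw [← inv_pow]
      have h6 : ((M : ℝ)⁻¹) ^ n ≤ (β ^ (s : ℝ)) ^ n := by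
        have hMp : (0 : ℝ) < M := by positivity
        gcongr
        rw [inv_le_iff_one_le_mul₀ hMp]
        linarith
      calc ((M : ℝ)⁻¹) ^ n ≤ (β ^ (s : ℝ)) ^ n := h6
        _ = (β * r) ^ (-(s : ℝ)) * (β ^ (n + 1) * r) ^ (s : ℝ) := by
          rw [Real.rpow_neg (by positivity), ← Real.inv_rpow (by positivity),
            ← Real.mul_rpow (by positivity) (by positivity), ← Real.rpow_natCast,
            ← Real.rpow_mul hβ0.le, mul_comm (s : ℝ), Real.rpow_mul hβ0.le, Real.rpow_natCast]
          congr 1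
          field_simp
          ring
        _ ≤ (β * r) ^ (-(s : ℝ)) * dist (a w) (a w') ^ (s : ℝ) := by gcongr
    rw [edist_dist, edist_dist, ENNReal.ofReal_rpow_of_nonneg dist_nonneg (by positivity)]
    calc ENNReal.ofReal (dist (π (a w)) (π (a w')))
        ≤ ENNReal.ofReal ((β * r) ^ (-(s : ℝ)) * dist (a w) (a w') ^ (s : ℝ)) :=
          ENNReal.ofReal_le_ofReal h4
      _ = _ := by
        rw [ENNReal.ofReal_mul hC]
        rfl
  refine ⟨range a, ?_, ?_⟩
  · have h1 := hold.dimH_image_le hs0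
    have h2 : Icc (0 : ℝ) 1 ⊆ π '' range a := by
      intro t ht
      obtain ⟨w, -, hw⟩ := Real.ofDigits_SurjOn hM ht
      exact ⟨a w, ⟨w, rfl⟩, by rw [hπ, hw]⟩
    have h3 : dimH (Icc (0 : ℝ) 1) = 1 := by
      rw [Real.dimH_of_nonempty_interior (by simp)]
      simp
    have h4 : 1 ≤ dimH (range a) / s := by
      rw [← h3]; exact (dimH_mono h2).trans h1
    have hs' : (s : ℝ≥0∞) ≠ 0 := by exact_mod_cast hs0.ne'
    rwa [ENNReal.le_div_iff_mul_le (Or.inl hs') (Or.inl ENNReal.coe_ne_top), one_mul] at h4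
  · rintro _ ⟨w, rfl⟩
    refine ⟨X w, fun n => ⟨hmem w n, hin w n, ?_⟩⟩
    rw [XS]
    exact (hf n _ (hin w n) (w n)).2

section SmoothOperators

variable {E F : Type*} [NormedAddCommGroup E] [NormedSpace ℝ E]
  [NormedAddCommGroup F] [NormedSpace ℝ F]

variable (E F) in
/-- The space of smooth functions between two normed spaces. -/
def smoothFns : Submodule ℝ (E → F) where
  carrier := {f | ContDiff ℝ (⊤ : ℕ∞) f}
  add_mem' hf hg := mem_ofPred.2 ((mem_ofPred.1 hf).add (mem_ofPred.1 hg))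
  zero_mem' := mem_ofPred.2 contDiff_zero_fun
  smul_mem' c _ hf := mem_ofPred.2 ((mem_ofPred.1 hf).const_smul c)

lemma mem_smoothFns {f : E → F} : f ∈ smoothFns E F ↔ ContDiff ℝ (⊤ : ℕ∞) f := mem_ofPred

lemma smoothFns.contDiff (f : smoothFns E F) : ContDiff ℝ (⊤ : ℕ∞) (f : E → F) :=
  mem_smoothFns.1 f.2

lemma ContDiff.dirD {f : E → F} (hf : ContDiff ℝ (⊤ : ℕ∞) f) (v : E) :
    ContDiff ℝ (⊤ : ℕ∞) (dirD v f) :=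
  (hf.fderiv_right (m := (⊤ : ℕ∞)) (by norm_cast)).clm_apply contDiff_const

lemma smoothFns.differentiable (f : smoothFns E F) : Differentiable ℝ (f : E → F) :=
  (smoothFns.contDiff f).differentiable (by simp)

/-- The directional derivative as an endomorphism of the space of smooth functions. -/
def dirOp (v : E) : Module.End ℝ (smoothFns E F) where
  toFun f := ⟨dirD v f, mem_smoothFns.2 (ContDiff.dirD (smoothFns.contDiff f) v)⟩
  map_add' f g := by
    ext x
    simp [dirD, fderiv_add (smoothFns.differentiable f x)
      (smoothFns.differentiable g x)]
  map_smul' c f := by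
    ext x
    simp [dirD, fderiv_const_smul (smoothFns.differentiable f x)]

@[simp] lemma coe_dirOp (v : E) (f : smoothFns E F) : (dirOp v f : E → F) = dirD v f := rfl

lemma dirOp_commute (v w : E) : Commute (dirOp v : Module.End ℝ (smoothFns E F)) (dirOp w) := by
  ext f x
  have hf : ContDiff ℝ (⊤ : ℕ∞) (f : E → F) := smoothFns.contDiff f
  have hd : DifferentiableAt ℝ (fderiv ℝ (f : E → F)) x :=
    (hf.fderiv_right (m := (⊤ : ℕ∞)) (by norm_cast)).differentiable (by simp) x
  have h (u u' : E) : dirD u (dirD u' (f : E → F)) x = fderiv ℝ (fderiv ℝ (f : E → F)) x u u' := by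
    unfold dirD
    rw [fderiv_clm_apply hd (differentiableAt_const u')]
    simp
  change dirD v (dirD w (f : E → F)) x = dirD w (dirD v (f : E → F)) x
  rw [h, h]
  exact ((hf.of_le (m := ((2 : ℕ∞) : WithTop ℕ∞)) (by exact_mod_cast le_top)).contDiffAt.isSymmSndFDerivAt (by simp)).eq v w

lemma coe_dirOp_pow (v : E) (n : ℕ) (f : smoothFns E F) :
    (((dirOp v : Module.End ℝ (smoothFns E F)) ^ n) f : E → F) = (dirD v)^[n] f := by
  induction n with
  | zero => rfl
  | succ n ih =>
    rw [pow_succ', Function.iterate_succ_apply', ← ih]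
    rfl

/-- Mixed partial derivatives as endomorphisms of the space of smooth functions. -/
def multiOp {ι : Type*} [Fintype ι] (e : ι → E) (α : ι → ℕ) : Module.End ℝ (smoothFns E F) :=
  ((Finset.univ : Finset ι).toList.map fun i => dirOp (e i) ^ α i).prod

lemma coe_multiOp {ι : Type*} [Fintype ι] (e : ι → E) (α : ι → ℕ) (f : smoothFns E F) :
    (multiOp e α f : E → F) = multiD e α f := by
  unfold multiOp multiD
  induction (Finset.univ : Finset ι).toList with
  | nil => rfl
  | cons i l ih =>
    rw [List.map_cons, List.prod_cons, List.foldr_cons, ← ih]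
    exact coe_dirOp_pow _ _ _

lemma dirOp_sum_pow {ι : Type*} [Fintype ι] [DecidableEq ι] (e : ι → E) (h : ι → ℝ) (n : ℕ) :
    (dirOp (∑ i, h i • e i) : Module.End ℝ (smoothFns E F)) ^ n =
      ∑ α ∈ Finset.univ.piAntidiag n,
        ((Nat.multinomial Finset.univ α : ℝ) * ∏ i, h i ^ α i) • multiOp e α := by
  have h1 : (dirOp (∑ i, h i • e i) : Module.End ℝ (smoothFns E F)) =
      ∑ i, h i • dirOp (e i) := by
    ext f x
    simp [dirD, LinearMap.sum_apply]
  rw [h1, Finset.sum_pow_eq_sum_piAntidiag_of_commute _ _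
    (fun i _ j _ _ => ((dirOp_commute (e i) (e j)).smul_left _).smul_right _)]
  refine Finset.sum_congr rfl fun α _ => ?_
  rw [(Finset.noncommProd_congr (Finset.toList_toFinset _).symm (fun _ _ => rfl) _).trans
    (Finset.noncommProd_toFinset _ _ _ (Finset.nodup_toList _))]
  have h2 (l : List ι) : (l.map fun i => (h i • dirOp (e i) : Module.End ℝ (smoothFns E F)) ^ α i).prod
      = (l.map fun i => h i ^ α i).prod • (l.map fun i => dirOp (e i) ^ α i).prod := by
    induction l with
    | nil => simp
    | cons i l ih =>
      rw [List.map_cons, List.prod_cons, List.map_cons, List.prod_cons, List.map_cons,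
        List.prod_cons, ih, smul_pow, smul_mul_smul_comm]
  rw [h2, Finset.prod_map_toList, mul_smul, multiOp, ← nsmul_eq_mul, Nat.cast_smul_eq_nsmul]

lemma iteratedDeriv_comp_line (f : smoothFns E F) (x h : E) (n : ℕ) :
    iteratedDeriv n (fun t : ℝ => (f : E → F) (x + t • h)) =
      fun t => ((dirOp h ^ n) f : E → F) (x + t • h) := by
  induction n with
  | zero => simp
  | succ n ih =>
    rw [iteratedDeriv_succ, ih]
    ext t
    rw [pow_succ']
    change _ = fderiv ℝ ((dirOp h ^ n) f : E → F) (x + t • h) h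
    have h1 : HasDerivAt (fun t : ℝ => x + t • h) h t := by
      simpa using ((hasDerivAt_id t).smul_const h).const_add x
    exact ((smoothFns.differentiable _ _).hasFDerivAt.comp_hasDerivAt t h1).deriv

end SmoothOperators

/-- Multi-indices of degree at most `n`. -/
def multiIdx (k n : ℕ) : Finset (Fin k → ℕ) :=
  (Finset.range (n + 1)).biUnion fun j => Finset.univ.piAntidiag j

lemma mem_multiIdx {k n : ℕ} {α : Fin k → ℕ} : α ∈ multiIdx k n ↔ ∑ i, α i ≤ n := by
  simp [multiIdx]

lemma sum_multiIdx {k : ℕ} {A : Type*} [AddCommMonoid A] (n : ℕ) (g : (Fin k → ℕ) → A) :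
    ∑ α ∈ multiIdx k n, g α = ∑ j ∈ Finset.range (n + 1), ∑ α ∈ Finset.univ.piAntidiag j, g α := by
  refine Finset.sum_biUnion fun i _ j _ hij => Finset.disjoint_left.2 fun α hi hj => hij ?_
  rw [Finset.mem_piAntidiag] at hi hj
  exact hi.1.symm.trans hj.1

/-- The Taylor coefficient `1 / α!`. -/
def taylorCoef {k : ℕ} (α : Fin k → ℕ) : ℝ :=
  (Nat.multinomial Finset.univ α : ℝ) / ((∑ i, α i).factorial : ℝ)

lemma taylorCoef_pos {k : ℕ} (α : Fin k → ℕ) : 0 < taylorCoef α :=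
  div_pos (by exact_mod_cast Nat.multinomial_pos _ _) (by positivity)

lemma contDiff_mderiv {k : ℕ} {F : Type*} [NormedAddCommGroup F] [NormedSpace ℝ F]
    {Φ : (Fin k → ℝ) → F} (hΦ : ContDiff ℝ (⊤ : ℕ∞) Φ) (α : Fin k → ℕ) :
    ContDiff ℝ (⊤ : ℕ∞) (mderiv α Φ) := by
  have := coe_multiOp (fun i : Fin k => (Pi.single i (1 : ℝ) : Fin k → ℝ)) α
    (⟨Φ, mem_smoothFns.2 hΦ⟩ : smoothFns (Fin k → ℝ) F)
  rw [mderiv, ← this]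
  exact smoothFns.contDiff _

lemma abs_monomial_le {k : ℕ} (h : Fin k → ℝ) (α : Fin k → ℕ) {ρ : ℝ} (hh : ‖h‖ ≤ ρ) :
    |∏ i, h i ^ α i| ≤ ρ ^ ∑ i, α i := by
  rw [Finset.abs_prod, ← Finset.prod_pow_eq_pow_sum]
  refine Finset.prod_le_prod (fun _ _ => abs_nonneg _) fun i _ => ?_
  rw [abs_pow]
  exact pow_le_pow_left₀ (abs_nonneg _) ((norm_le_pi_norm h i).trans hh) _

/-- Multivariate Taylor formula with uniform remainder bound. -/
lemma exists_taylor_bound {k : ℕ} {F : Type*} [NormedAddCommGroup F] [NormedSpace ℝ F]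
    {Φ : (Fin k → ℝ) → F} (hΦ : ContDiff ℝ (⊤ : ℕ∞) Φ) (v : Fin k → ℝ) (n : ℕ) :
    ∃ C : ℝ, 0 < C ∧ ∀ x ∈ closedBall v 1, ∀ h : Fin k → ℝ, ‖h‖ ≤ 1 →
      ‖Φ (x + h) - ∑ α ∈ multiIdx k n, (∏ i, h i ^ α i) • (taylorCoef α • mderiv α Φ x)‖ ≤
        C * ‖h‖ ^ (n + 1) := by
  have hB (α : Fin k → ℕ) : ∃ B : ℝ, ∀ y ∈ closedBall v 2, ‖mderiv α Φ y‖ ≤ B :=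
    (isCompact_closedBall v 2).exists_bound_of_continuousOn
      (contDiff_mderiv hΦ α).continuous.continuousOn
  choose B hB using hB
  have hB0 (α) : 0 ≤ B α := (norm_nonneg _).trans (hB α v (mem_closedBall_self (by norm_num)))
  set K : ℝ := ∑ α ∈ Finset.univ.piAntidiag (n + 1), (Nat.multinomial Finset.univ α : ℝ) * B α
    with hK
  have hK0 : 0 ≤ K := Finset.sum_nonneg fun α _ => mul_nonneg (by positivity) (hB0 α)
  refine ⟨K + 1, by positivity, fun x hx h hh => ?_⟩
  let f : smoothFns (Fin k → ℝ) F := ⟨Φ, mem_smoothFns.2 hΦ⟩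
  let e : Fin k → Fin k → ℝ := fun i => Pi.single i 1
  have he : ∑ i, h i • e i = h := by
    ext j
    simp [e, Finset.sum_apply, Pi.single_apply]
  have hpow (j : ℕ) (y : Fin k → ℝ) : ((dirOp h ^ j) f : (Fin k → ℝ) → F) y =
      ∑ α ∈ Finset.univ.piAntidiag j,
        ((Nat.multinomial Finset.univ α : ℝ) * ∏ i, h i ^ α i) • mderiv α Φ y := by
    have := dirOp_sum_pow (E := Fin k → ℝ) (F := F) e h j
    rw [he] at this
    rw [this, LinearMap.sum_apply, Submodule.coe_sum, Finset.sum_apply]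
    refine Finset.sum_congr rfl fun α _ => ?_
    rw [LinearMap.smul_apply, Submodule.coe_smul, Pi.smul_apply, coe_multiOp]
    rfl
  let φ : ℝ → F := fun t => Φ (x + t • h)
  have hφ : ContDiff ℝ (⊤ : ℕ∞) φ :=
    hΦ.comp (contDiff_const.add (contDiff_id.smul contDiff_const))
  have hit (j : ℕ) (t : ℝ) (ht : t ∈ Icc (0 : ℝ) 1) : iteratedDerivWithin j φ (Icc 0 1) t =
      ∑ α ∈ Finset.univ.piAntidiag j,
        ((Nat.multinomial Finset.univ α : ℝ) * ∏ i, h i ^ α i) • mderiv α Φ (x + t • h) := by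
    rw [iteratedDerivWithin_eq_iteratedDeriv (uniqueDiffOn_Icc zero_lt_one)
      (hφ.contDiffAt.of_le (by exact_mod_cast le_top)) ht, ← hpow]
    exact congrFun (iteratedDeriv_comp_line f x h j) t
  have hC : ∀ t ∈ Icc (0 : ℝ) 1,
      ‖iteratedDerivWithin (n + 1) φ (Icc 0 1) t‖ ≤ K * ‖h‖ ^ (n + 1) := by
    intro t ht
    rw [hit _ t ht, hK, Finset.sum_mul]
    refine norm_sum_le_of_le _ fun α hα => ?_
    rw [Finset.mem_piAntidiag] at hα
    have h1 := abs_monomial_le h α le_rfl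
    rw [hα.1] at h1
    have h2 : ‖mderiv α Φ (x + t • h)‖ ≤ B α := by
      refine hB α _ ?_
      rw [mem_closedBall, dist_eq_norm] at hx ⊢
      calc ‖x + t • h - v‖ = ‖(x - v) + t • h‖ := by congr 1; abel
        _ ≤ ‖x - v‖ + ‖t • h‖ := norm_add_le _ _
        _ ≤ 1 + 1 * 1 := by
          rw [norm_smul, Real.norm_of_nonneg ht.1]
          gcongr
          exact ht.2
        _ = 2 := by norm_num
    rw [norm_smul, Real.norm_eq_abs, abs_mul, Nat.abs_cast, mul_right_comm]
    gcongr
    exact mul_nonneg (by positivity) (hB0 α)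
  have h3 := taylor_mean_remainder_bound (f := φ) zero_le_one
    (hφ.of_le (by exact_mod_cast le_top)).contDiffOn (right_mem_Icc.2 zero_le_one) hC
  have h4 : taylorWithinEval φ n (Icc 0 1) 0 1 =
      ∑ α ∈ multiIdx k n, (∏ i, h i ^ α i) • (taylorCoef α • mderiv α Φ x) := by
    rw [taylor_within_apply, sum_multiIdx]
    refine Finset.sum_congr rfl fun j _ => ?_
    rw [hit j 0 (left_mem_Icc.2 zero_le_one), Finset.smul_sum]
    refine Finset.sum_congr rfl fun α hα => ?_
    rw [Finset.mem_piAntidiag] at hα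
    rw [smul_smul, smul_smul, taylorCoef, hα.1]
    simp only [sub_zero, one_pow, mul_one, zero_smul, add_zero]
    congr 1
    ring
  rw [h4] at h3
  simp only [φ, one_smul, sub_zero, one_pow, mul_one] at h3
  refine h3.trans ?_
  rw [div_le_iff₀ (by positivity)]
  have : (1 : ℝ) ≤ (n.factorial : ℝ) := by exact_mod_cast n.factorial_pos
  nlinarith [mul_nonneg hK0 (pow_nonneg (norm_nonneg h) (n + 1)),
    pow_nonneg (norm_nonneg h) (n + 1), mul_nonneg (mul_nonneg hK0 (pow_nonneg (norm_nonneg h) (n + 1))) (sub_nonneg.2 this)]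

lemma card_piAntidiag_univ_fin {k : ℕ} (hk : 1 ≤ k) (j : ℕ) :
    (Finset.univ.piAntidiag j : Finset (Fin k → ℕ)).card = (k - 1 + j).choose j := by
  rw [← Finset.map_sym_eq_piAntidiag, Finset.card_map, Finset.sym_univ, Finset.card_univ,
    Sym.card_sym_eq_choose, Fintype.card_fin]
  congr 1
  omega

/-- The lower bound for the total degree of a family of `d + 1` pairwise distinct monomials of
degree at most `n` and remainder terms of degree `n + 1`. -/
lemma le_sum_degree {k : ℕ} (hk : 1 ≤ k) {n d : ℕ} (hn : Ssum k n ≤ d)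
    (r : Fin (d + 1) → Option (multiIdx k n))
    (hr : ∀ i j α, r i = some α → r j = some α → i = j) :
    (∑ j ∈ Finset.Icc 1 n, j * (k - 1 + j).choose j) + (n + 1) * (d - Ssum k n) ≤
      ∑ i, (r i).elim (n + 1) (fun α => ∑ l, α.1 l) := by
  set w : Option (multiIdx k n) → ℕ := fun τ => τ.elim 0 fun α => n + 1 - ∑ l, α.1 l with hw
  have h1 : ∑ i, w (r i) ≤ ∑ τ, w τ := by
    have h2 : ∑ i, w (r i) = ∑ i with r i ≠ none, w (r i) := by
      rw [Finset.sum_filter]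
      refine Finset.sum_congr rfl fun i _ => ?_
      rcases hri : r i with _ | α <;> simp [hw]
    rw [h2, ← Finset.sum_image (f := w) (g := r)]
    · exact Finset.sum_le_sum_of_subset (Finset.subset_univ _)
    · intro i hi j _ hij
      simp only [Finset.coe_filter, Finset.mem_univ, true_and] at hi
      obtain ⟨α, hα⟩ := Option.ne_none_iff_exists'.1 hi
      exact hr i j α hα (hij ▸ hα)
  have h3 : ∑ τ, w τ = ∑ j ∈ Finset.range (n + 1), (k - 1 + j).choose j * (n + 1 - j) := by
    rw [Fintype.sum_option]
    simp only [hw, Option.elim_none, Option.elim_some, zero_add]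
    rw [Finset.sum_coe_sort (multiIdx k n) (fun α => n + 1 - ∑ l, α l), sum_multiIdx]
    refine Finset.sum_congr rfl fun j _ => ?_
    rw [← card_piAntidiag_univ_fin hk, ← smul_eq_mul, ← Finset.sum_const]
    refine Finset.sum_congr rfl fun α hα => ?_
    rw [(Finset.mem_piAntidiag.1 hα).1]
  have h4 : ∑ i, w (r i) + ∑ i, (r i).elim (n + 1) (fun α => ∑ l, α.1 l) = (d + 1) * (n + 1) := by
    rw [← Finset.sum_add_distrib, Finset.sum_congr rfl (g := fun _ => n + 1)]
    · simp
    · intro i _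
      rcases hri : r i with _ | α
      · simp [hw]
      · have := mem_multiIdx.1 α.2
        simp only [hw, Option.elim_some]
        omega
  have h5 : ∑ j ∈ Finset.range (n + 1), (k - 1 + j).choose j * (n + 1 - j) +
      ∑ j ∈ Finset.Icc 1 n, j * (k - 1 + j).choose j = (n + 1) * (1 + Ssum k n) := by
    rw [Finset.range_eq_Ico, Finset.sum_eq_sum_Ico_succ_bot (Nat.succ_pos n), Ssum, add_assoc]
    have : Finset.Ico (0 + 1) (n + 1) = Finset.Icc 1 n := by ext; simp
    rw [this, ← Finset.sum_add_distrib, mul_add, Finset.mul_sum]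
    congr 1
    · simp
    · refine Finset.sum_congr rfl fun j hj => ?_
      rw [Finset.mem_Icc] at hj
      obtain ⟨t, ht⟩ := Nat.exists_eq_add_of_le hj.2
      rw [ht, show j + t + 1 - j = t + 1 by omega]
      ring
  obtain ⟨m, hm⟩ := Nat.exists_eq_add_of_le hn
  rw [show d - Ssum k n = m by omega]
  have h6 : (d + 1) * (n + 1) = (n + 1) * (1 + Ssum k n) + (n + 1) * m := by
    rw [show d + 1 = 1 + Ssum k n + m by omega]
    ring
  rw [h3] at h1
  omega

lemma abs_det_le {m : ℕ} (A : Matrix (Fin m) (Fin m) ℝ) {K : ℝ} (hA : ∀ i, ‖A i‖ ≤ K) :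
    |A.det| ≤ m.factorial * K ^ m := by
  have := Matrix.det_le (A := A) (abv := AbsoluteValue.abs) (x := K)
    fun i j => (norm_le_pi_norm (A i) j).trans (hA i)
  simpa [nsmul_eq_mul] using this

/-- The generalized Wronskian-type upper bound for determinants of nearby points on a smooth
`k`-dimensional family of vectors. -/
lemma exists_det_bound {k : ℕ} (hk : 1 ≤ k) {d n : ℕ} (hn : Ssum k n ≤ d)
    {F : (Fin k → ℝ) → (Fin (d + 1) → ℝ)} (hF : ContDiff ℝ (⊤ : ℕ∞) F) (v : Fin k → ℝ) :
    ∃ C : ℝ, 0 < C ∧ ∀ x ∈ closedBall v 1, ∀ ρ : ℝ, 0 < ρ → ρ ≤ 1 →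
      ∀ h : Fin (d + 1) → (Fin k → ℝ), (∀ i, ‖h i‖ ≤ ρ) →
        |(Matrix.of fun i => F (x + h i)).det| ≤
          C * ρ ^ ((∑ j ∈ Finset.Icc 1 n, j * (k - 1 + j).choose j) +
            (n + 1) * (d - Ssum k n)) := by
  classical
  obtain ⟨C, hC0, hC⟩ := exists_taylor_bound hF v n
  have hB (α : Fin k → ℕ) : ∃ B : ℝ, ∀ y ∈ closedBall v 1, ‖taylorCoef α • mderiv α F y‖ ≤ B := by
    have hcont : Continuous (mderiv α F) := (contDiff_mderiv hF α).continuous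
    have hcont' : Continuous fun y => taylorCoef α • mderiv α F y := by fun_prop
    exact (isCompact_closedBall v 1).exists_bound_of_continuousOn hcont'.continuousOn
  choose B hB using hB
  have hB0 (α) : 0 ≤ B α := (norm_nonneg _).trans (hB α v (mem_closedBall_self (by norm_num)))
  set N := (∑ j ∈ Finset.Icc 1 n, j * (k - 1 + j).choose j) + (n + 1) * (d - Ssum k n) with hN
  set K : ℝ := C + ∑ α ∈ multiIdx k n, B α with hK
  have hCK : C ≤ K := le_add_of_nonneg_right (Finset.sum_nonneg fun α _ => hB0 α)
  have hBK (α) (hα : α ∈ multiIdx k n) : B α ≤ K :=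
    (Finset.single_le_sum (f := B) (fun α _ => hB0 α) hα).trans (le_add_of_nonneg_left hC0.le)
  have hK0 : 0 < K := hC0.trans_le hCK
  let T := Option (multiIdx k n)
  refine ⟨(Fintype.card (Fin (d + 1) → T) : ℝ) * ((d + 1).factorial * K ^ (d + 1)),
    mul_pos (by exact_mod_cast Fintype.card_pos) (by positivity), ?_⟩
  intro x hx ρ hρ0 hρ1 h hh
  let R : Fin (d + 1) → Fin (d + 1) → ℝ := fun i =>
    F (x + h i) - ∑ α ∈ multiIdx k n, (∏ l, h i l ^ α l) • (taylorCoef α • mderiv α F x)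
  have hR (i) : ‖R i‖ ≤ K * ρ ^ (n + 1) := by
    refine (hC x hx (h i) ((hh i).trans hρ1)).trans ?_
    gcongr
    exact hh i
  let c : Fin (d + 1) → T → ℝ := fun i τ => τ.elim (ρ ^ (n + 1)) fun α => ∏ l, h i l ^ α.1 l
  let b : Fin (d + 1) → T → Fin (d + 1) → ℝ := fun i τ =>
    τ.elim ((ρ ^ (n + 1))⁻¹ • R i) fun α => taylorCoef α.1 • mderiv α.1 F x
  have hc (i τ) : |c i τ| ≤ ρ ^ (τ.elim (n + 1) fun α => ∑ l, α.1 l) := by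
    rcases τ with _ | α
    · simp only [c, Option.elim_none]
      rw [abs_of_nonneg (by positivity)]
    · exact abs_monomial_le (h i) α.1 (hh i)
  have hb (i τ) : ‖b i τ‖ ≤ K := by
    rcases τ with _ | α
    · simp only [b, Option.elim_none]
      rw [norm_smul, norm_inv, Real.norm_of_nonneg (by positivity), inv_mul_le_iff₀ (by positivity),
        mul_comm]
      exact hR i
    · exact (hB α.1 x hx).trans (hBK α.1 α.2)
  have hrow (i) : F (x + h i) = ∑ τ, c i τ • b i τ := by
    rw [Fintype.sum_option]
    simp only [c, b, Option.elim_none, Option.elim_some]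
    rw [smul_inv_smul₀ (by positivity),
      Finset.sum_coe_sort (multiIdx k n)
        (fun α => (∏ l, h i l ^ α l) • (taylorCoef α • mderiv α F x))]
    simp [R]
  have hexp : (Matrix.of fun i => F (x + h i)).det =
      ∑ r : Fin (d + 1) → T, (∏ i, c i (r i)) * (Matrix.of fun i => b i (r i)).det := by
    have h1 := (Matrix.detRowAlternating (n := Fin (d + 1)) (R := ℝ)).toMultilinearMap.map_sum
      (fun i τ => c i τ • b i τ)
    have h2 : (Matrix.of fun i => F (x + h i)).det =
        (Matrix.detRowAlternating (n := Fin (d + 1)) (R := ℝ)).toMultilinearMap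
          (fun i => ∑ τ, c i τ • b i τ) := by
      simp_rw [← hrow]
      rfl
    rw [h2, h1]
    refine Finset.sum_congr rfl fun r _ => ?_
    exact MultilinearMap.map_smul_univ _ (fun i => c i (r i)) (fun i => b i (r i))
  rw [hexp, mul_assoc, ← nsmul_eq_mul, ← Finset.card_univ, ← Finset.sum_const]
  refine (Finset.abs_sum_le_sum_abs _ _).trans (Finset.sum_le_sum fun r _ => ?_)
  by_cases hr : ∀ i j α, r i = some α → r j = some α → i = j
  · rw [abs_mul, mul_comm]
    refine mul_le_mul (abs_det_le _ fun i => hb i (r i)) ?_ (abs_nonneg _) (by positivity)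
    rw [Finset.abs_prod]
    refine (Finset.prod_le_prod (fun _ _ => abs_nonneg _) fun i _ => hc i (r i)).trans ?_
    rw [Finset.prod_pow_eq_pow_sum]
    exact pow_le_pow_of_le_one hρ0.le hρ1 (le_sum_degree hk hn r hr)
  · push Not at hr
    obtain ⟨i, j, α, hi, hj, hij⟩ := hr
    rw [Matrix.det_zero_of_row_eq hij, mul_zero, abs_zero]
    · positivity
    · change b i (r i) = b j (r j)
      rw [hi, hj]
      rfl

lemma Ssum_zero (k : ℕ) : Ssum k 0 = 0 := by simp [Ssum]

lemma le_Ssum (k n : ℕ) : n ≤ Ssum k n := by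
  calc n = ∑ j ∈ Finset.Icc 1 n, 1 := by simp
    _ ≤ Ssum k n := Finset.sum_le_sum fun j _ => Nat.choose_pos (Nat.le_add_left _ _)

lemma bddAbove_Ssum_le (k d : ℕ) : BddAbove {n : ℕ | Ssum k n ≤ d} :=
  ⟨d, fun n hn => (le_Ssum k n).trans (mem_ofPred.1 hn)⟩

lemma Ssum_nkd_le (k d : ℕ) : Ssum k (nkd k d) ≤ d :=
  mem_ofPred.1 (Nat.sSup_mem (s := {n : ℕ | Ssum k n ≤ d})
    ⟨0, mem_ofPred.2 (by simp [Ssum_zero])⟩ (bddAbove_Ssum_le k d))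

lemma Nkd_pos {k d : ℕ} (hk : 1 ≤ k) (hkd : k ≤ d) : 0 < Nkd k d := by
  have h1 : 1 ≤ nkd k d := by
    refine le_csSup (bddAbove_Ssum_le k d) (mem_ofPred.2 ?_)
    simp only [Ssum, Finset.Icc_self, Finset.sum_singleton, Nat.choose_one_right]
    omega
  refine Nat.add_pos_left (Finset.sum_pos (fun j hj => ?_) ⟨1, by simp [h1]⟩) _
  rw [Finset.mem_Icc] at hj
  exact Nat.mul_pos hj.1 (Nat.choose_pos (Nat.le_add_left _ _))

lemma ckd_pos {k d : ℕ} (hk : 1 ≤ k) (hkd : k ≤ d) : 0 < ckd k d :=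
  div_pos (by positivity) (by exact_mod_cast Nkd_pos hk hkd)

lemma IsRatPt.ht_mem {d : ℕ} {x : Fin d → ℝ} (hx : IsRatPt x) :
    0 < ht x ∧ ∀ i, ∃ m : ℤ, (ht x : ℝ) * x i = (m : ℝ) := by
  choose a ha using hx
  refine mem_ofPred.1 (Nat.sInf_mem (s := {q : ℕ | 0 < q ∧ ∀ i, ∃ m : ℤ, (q : ℝ) * x i = (m : ℝ)})
    ⟨∏ i, (a i).den, mem_ofPred.2 ⟨Finset.prod_pos fun i _ => (a i).den_pos, fun i => ?_⟩⟩)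
  refine ⟨(∏ j ∈ Finset.univ.erase i, ((a j).den : ℤ)) * (a i).num, ?_⟩
  rw [← Finset.mul_prod_erase Finset.univ _ (Finset.mem_univ i), ha]
  have h1 : ((a i).den : ℝ) * (a i : ℝ) = (a i).num := by
    exact_mod_cast Rat.den_mul_eq_num (a i)
  push_cast
  rw [mul_right_comm, h1, mul_comm]

lemma IsRatPt.ht_pos {d : ℕ} {x : Fin d → ℝ} (hx : IsRatPt x) : 0 < ht x := hx.ht_mem.1

/-- The determinant of the homogeneous coordinates of `d + 1` rational points is bounded from
below by the product of the inverses of the heights. -/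
lemma one_le_prod_ht_mul_abs_det {d : ℕ} (r : Fin (d + 1) → Fin d → ℝ) (hr : ∀ i, IsRatPt (r i))
    (h0 : (Matrix.of fun i => (Fin.cons 1 (r i) : Fin (d + 1) → ℝ)).det ≠ 0) :
    1 ≤ (∏ i, (ht (r i) : ℝ)) * |(Matrix.of fun i => (Fin.cons 1 (r i) : Fin (d + 1) → ℝ)).det| := by
  choose m hm using fun i => (hr i).ht_mem.2
  set A : Matrix (Fin (d + 1)) (Fin (d + 1)) ℝ := Matrix.of fun i => Fin.cons 1 (r i) with hA
  let B : Matrix (Fin (d + 1)) (Fin (d + 1)) ℤ := Matrix.of fun i => Fin.cons (ht (r i) : ℤ) (m i)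
  have h1 : ((B.det : ℤ) : ℝ) = (∏ i, (ht (r i) : ℝ)) * A.det := by
    rw [← Matrix.det_mul_column, Int.cast_det]
    congr 1
    ext i j
    refine Fin.cases ?_ (fun j => ?_) j
    · simp [A, B]
    · simp [A, B, hm]
  have h2 : (0 : ℝ) < ∏ i, (ht (r i) : ℝ) :=
    Finset.prod_pos fun i _ => by exact_mod_cast (hr i).ht_pos
  have h3 : B.det ≠ 0 := by
    intro h
    rw [h, Int.cast_zero] at h1
    exact mul_ne_zero h2.ne' h0 h1.symm
  rw [← abs_of_pos h2, ← abs_mul, ← h1]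
  exact_mod_cast Int.one_le_abs h3

/-- A subset of `ℝ^d` any `d + 1` points of which have vanishing determinant of homogeneous
coordinates lies in an affine hyperplane. -/
lemma exists_hyperplane {d : ℕ} (hd : 1 ≤ d) (S : Set (Fin d → ℝ))
    (hS : ∀ r : Fin (d + 1) → Fin d → ℝ, (∀ i, r i ∈ S) →
      (Matrix.of fun i => (Fin.cons 1 (r i) : Fin (d + 1) → ℝ)).det = 0) :
    ∃ (b : ℝ) (w : Fin d → ℝ), w ≠ 0 ∧ ∀ r ∈ S, b + ∑ i, w i * r i = 0 := by
  rcases S.eq_empty_or_nonempty with rfl | ⟨r₀, hr₀⟩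
  · exact ⟨0, fun _ => 1, fun h => one_ne_zero (congrFun h ⟨0, hd⟩), fun r hr => absurd hr (by simp)⟩
  set V := (fun r : Fin d → ℝ => (Fin.cons 1 r : Fin (d + 1) → ℝ)) '' S with hV
  have h1 : Submodule.span ℝ V < ⊤ := by
    refine lt_top_iff_ne_top.2 fun htop => ?_
    have hfr : Module.finrank ℝ (Submodule.span ℝ V) = d + 1 := by
      rw [htop, finrank_top, Module.finrank_fin_fun]
    obtain ⟨u, hu, -, hui⟩ := Submodule.exists_fun_fin_finrank_span_eq ℝ V
    choose r hr hru using fun i : Fin (d + 1) => hu (Fin.cast hfr.symm i)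
    have h3 : LinearIndependent ℝ (Matrix.of fun i => (Fin.cons 1 (r i) : Fin (d + 1) → ℝ)).row := by
      have h4 : LinearIndependent ℝ fun i => u (Fin.cast hfr.symm i) :=
        hui.comp (Fin.cast hfr.symm) (Fin.cast_injective _)
      rwa [← funext hru] at h4
    rw [Matrix.linearIndependent_rows_iff_isUnit, Matrix.isUnit_iff_isUnit_det, hS r hr] at h3
    exact not_isUnit_zero h3
  obtain ⟨f, hf0, hf⟩ := Submodule.exists_le_ker_of_lt_top _ h1
  have h2 (r : Fin d → ℝ) (hr : r ∈ S) :
      f (Pi.single 0 1) + ∑ i, f (Pi.single i.succ 1) * r i = 0 := by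
    have h3 : f (Fin.cons 1 r) = 0 := hf (Submodule.subset_span ⟨r, hr, rfl⟩)
    rw [LinearMap.pi_apply_eq_sum_univ, Fin.sum_univ_succ] at h3
    simp only [Fin.cons_zero, Fin.cons_succ, smul_eq_mul, one_mul] at h3
    have h4 (i : Fin (d + 1)) :
        (fun j => if i = j then 1 else 0 : Fin (d + 1) → ℝ) = Pi.single i 1 := by
      ext j
      simp [Pi.single_apply, eq_comm]
    simpa only [h4, mul_comm] using h3
  refine ⟨f (Pi.single 0 1), fun i => f (Pi.single i.succ 1), fun hw => hf0 ?_, h2⟩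
  have h3 := h2 r₀ hr₀
  simp only [fun i => congrFun hw i, Pi.zero_apply, zero_mul, Finset.sum_const_zero, add_zero] at h3
  refine LinearMap.pi_ext' fun i => LinearMap.ext_ring ?_
  refine Fin.cases ?_ (fun j => ?_) i
  · simpa using h3
  · simpa using congrFun hw j

/-- The simplex lemma: rational points of small height on a small piece of a smoothly parametrized
manifold lie in a common affine hyperplane. -/
lemma exists_hyperplane_of_ht_le {k d : ℕ} (hk : 1 ≤ k) (hkd : k ≤ d)
    {Φ : (Fin k → ℝ) → (Fin d → ℝ)} (hΦ : ContDiff ℝ (⊤ : ℕ∞) Φ) (v : Fin k → ℝ) :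
    ∃ κ : ℝ, 0 < κ ∧ ∀ x ∈ closedBall v 1, ∀ ρ : ℝ, 0 < ρ → ρ ≤ 1 →
      ∃ (b : ℝ) (w : Fin d → ℝ), w ≠ 0 ∧ ∀ y ∈ closedBall x ρ, IsRatPt (Φ y) →
        (ht (Φ y) : ℝ) ≤ κ * ρ ^ (-(1 / ckd k d)) → b + ∑ i, w i * Φ y i = 0 := by
  have hF : ContDiff ℝ (⊤ : ℕ∞) fun y => (Fin.cons 1 (Φ y) : Fin (d + 1) → ℝ) := by
    refine contDiff_pi.2 fun i => ?_
    refine Fin.cases ?_ (fun i => ?_) i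
    · simpa using contDiff_const
    · simpa using contDiff_pi.1 hΦ i
  obtain ⟨C, hC0, hC⟩ := exists_det_bound hk (Ssum_nkd_le k d) hF v
  set κ : ℝ := (C + 1)⁻¹ with hκ
  have hκ0 : 0 < κ := by positivity
  have hκ1 : κ ≤ 1 := inv_le_one_of_one_le₀ (by linarith)
  have hCκ : C * κ < 1 := by
    rw [hκ, ← div_eq_mul_inv, div_lt_one (by positivity)]
    linarith
  refine ⟨κ, hκ0, fun x hx ρ hρ0 hρ1 => ?_⟩
  obtain ⟨b, w, hw, h⟩ := exists_hyperplane (hk.trans hkd)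
    {r | ∃ y ∈ closedBall x ρ, Φ y = r ∧ IsRatPt r ∧ (ht r : ℝ) ≤ κ * ρ ^ (-(1 / ckd k d))} (by
      intro r hr
      choose y hy hyr hrat hht using fun i => mem_ofPred.1 (hr i)
      by_contra h0
      have h1 := one_le_prod_ht_mul_abs_det r hrat h0
      have h2 := hC x hx ρ hρ0 hρ1 (fun i => y i - x) fun i => by
        rw [← dist_eq_norm]
        exact hy i
      simp only [add_sub_cancel, hyr] at h2
      have h3 : ∏ i, (ht (r i) : ℝ) ≤ (κ * ρ ^ (-(1 / ckd k d))) ^ (d + 1) := by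
        refine (Finset.prod_le_prod (fun _ _ => Nat.cast_nonneg _) fun i _ => hht i).trans ?_
        simp
      have h4 : (κ * ρ ^ (-(1 / ckd k d))) ^ (d + 1) = κ ^ (d + 1) * (ρ ^ Nkd k d)⁻¹ := by
        have hN : (0 : ℝ) < Nkd k d := by exact_mod_cast Nkd_pos hk hkd
        rw [mul_pow, ← Real.rpow_natCast (ρ ^ _), ← Real.rpow_mul hρ0.le, ← Real.rpow_natCast ρ,
          ← Real.rpow_neg hρ0.le]
        congr 2
        rw [ckd]
        push_cast
        field_simp
      have h5 : κ ^ (d + 1) ≤ κ := pow_le_of_le_one hκ0.le hκ1 (by omega)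
      have h6 := h1.trans (mul_le_mul (h3.trans_eq h4) h2 (abs_nonneg _) (by positivity))
      have h7 : κ ^ (d + 1) * (ρ ^ Nkd k d)⁻¹ * (C * ρ ^ Nkd k d) = C * κ ^ (d + 1) := by
        have : ρ ^ Nkd k d ≠ 0 := (pow_pos hρ0 _).ne'
        field_simp
      have h8 : 1 ≤ C * κ ^ (d + 1) := h6.trans_eq h7
      nlinarith)
  exact ⟨b, w, hw, fun y hy hr hh => h _ (mem_ofPred.2 ⟨y, hy, rfl, hr, hh⟩)⟩

/-- The zero set of a nonzero real polynomial is a null set. -/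
lemma MvPolynomial.volume_zero_set {n : ℕ} (p : MvPolynomial (Fin n) ℝ) (hp : p ≠ 0) :
    volume {x : Fin n → ℝ | MvPolynomial.eval x p = 0} = 0 := by
  induction n with
  | zero =>
    have : {x : Fin 0 → ℝ | MvPolynomial.eval x p = 0} = ∅ := by
      refine Set.eq_empty_of_forall_notMem fun x hx => hp ?_
      have hx := mem_ofPred.1 hx
      rw [MvPolynomial.eq_C_of_isEmpty p] at hx ⊢
      rw [MvPolynomial.eval_C] at hx
      rw [hx, map_zero]
    rw [this, measure_empty]
  | succ n ih =>
    set q := MvPolynomial.finSuccEquiv ℝ n p with hq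
    have hq0 : q ≠ 0 := by simpa [hq] using hp
    have hS : MeasurableSet {x : Fin (n + 1) → ℝ | MvPolynomial.eval x p = 0} :=
      (isClosed_eq (MvPolynomial.continuous_eval p) continuous_const).measurableSet
    have hmp := volume_preserving_piFinSuccAbove (fun _ : Fin (n + 1) => ℝ) 0
    rw [← hmp.symm.measure_preimage hS.nullMeasurableSet]
    have hS' := hmp.symm.measurable hS
    rw [Measure.volume_eq_prod, Measure.prod_apply_symm hS']
    refine lintegral_eq_zero_of_ae_eq_zero ?_
    have h1 : ∀ᵐ s : Fin n → ℝ, MvPolynomial.eval s q.leadingCoeff ≠ 0 :=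
      (measure_eq_zero_iff_ae_notMem.1 (ih _ (Polynomial.leadingCoeff_ne_zero.2 hq0))).mono
        fun s hs h => hs (mem_ofPred.2 h)
    filter_upwards [h1] with s hs
    set f := Polynomial.map (MvPolynomial.eval s) q with hf
    have hf0 : f ≠ 0 := fun h => hs (by
      rw [Polynomial.leadingCoeff, ← Polynomial.coeff_map, ← hf, h, Polynomial.coeff_zero])
    refine (Set.Finite.subset (f.roots.toFinset.finite_toSet) fun y hy => ?_).measure_zero volume
    have hy : MvPolynomial.eval (Fin.cons y s : Fin (n + 1) → ℝ) p = 0 := by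
      have := mem_ofPred.1 hy
      simpa [MeasurableEquiv.piFinSuccAbove, Fin.insertNthEquiv] using this
    rw [MvPolynomial.eval_eq_eval_mv_eval'] at hy
    simpa [hf0] using hy

/-- The polynomial function with coefficients `c`. -/
def polyFun {k D : ℕ} (c : multiIdx k D → ℝ) (u : Fin k → ℝ) : ℝ :=
  ∑ α, c α * ∏ i, u i ^ α.1 i

lemma continuous_polyFun {k D : ℕ} :
    Continuous fun z : (multiIdx k D → ℝ) × (Fin k → ℝ) => polyFun z.1 z.2 := by
  unfold polyFun
  fun_prop

lemma volume_polyFun_zero {k D : ℕ} {c : multiIdx k D → ℝ} (hc : c ≠ 0) :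
    volume {u | polyFun c u = 0} = 0 := by
  classical
  let p : MvPolynomial (Fin k) ℝ :=
    ∑ α, MvPolynomial.monomial (Finsupp.equivFunOnFinite.symm α.1) (c α)
  have hp (u) : MvPolynomial.eval u p = polyFun c u := by
    simp only [p, map_sum, polyFun, MvPolynomial.eval_monomial]
    refine Finset.sum_congr rfl fun α _ => ?_
    congr 1
    rw [Finsupp.prod_fintype _ _ fun i => pow_zero _]
    rfl
  have hp0 : p ≠ 0 := by
    obtain ⟨α, hα⟩ := Function.ne_iff.1 hc
    intro h
    refine hα ?_
    have : p.coeff (Finsupp.equivFunOnFinite.symm α.1) = c α := by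
      simp only [p, MvPolynomial.coeff_sum, MvPolynomial.coeff_monomial]
      rw [Finset.sum_eq_single α]
      · simp
      · intro b _ hb
        rw [if_neg]
        exact fun h => hb (Subtype.ext (Finsupp.equivFunOnFinite.symm.injective h))
      · simp
    rw [← this, h, MvPolynomial.coeff_zero, Pi.zero_apply]
  simpa only [hp] using MvPolynomial.volume_zero_set p hp0

/-- Uniformly over normalized polynomials of bounded degree, the points close to a
sublevel set of a polynomial have small volume. -/
lemma exists_volume_sublevel_le (k D : ℕ) {δ : ℝ≥0∞} (hδ : 0 < δ) :
    ∃ ε : ℝ, 0 < ε ∧ ∃ η : ℝ, 0 < η ∧ ∀ c : multiIdx k D → ℝ, ‖c‖ = 1 →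
      volume {u ∈ closedBall (0 : Fin k → ℝ) 2 |
        ∃ u' ∈ closedBall (0 : Fin k → ℝ) 2, dist u' u ≤ η ∧ |polyFun c u'| ≤ ε} ≤ δ := by
  set B := closedBall (0 : Fin k → ℝ) 2 with hB
  have hBc : IsCompact B := isCompact_closedBall _ _
  have huc : UniformContinuousOn (fun z : (multiIdx k D → ℝ) × (Fin k → ℝ) => polyFun z.1 z.2)
      (closedBall 0 2 ×ˢ B) :=
    ((isCompact_closedBall _ _).prod hBc).uniformContinuousOn_of_continuous
      continuous_polyFun.continuousOn
  rw [Metric.uniformContinuousOn_iff] at huc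
  suffices ∃ ε : ℝ, 0 < ε ∧ ∀ c ∈ sphere (0 : multiIdx k D → ℝ) 1,
      volume (B ∩ {u | |polyFun c u| ≤ ε}) ≤ δ by
    obtain ⟨ε, hε, h⟩ := this
    obtain ⟨η, hη, hη'⟩ := huc (ε / 2) (by positivity)
    refine ⟨ε / 2, by positivity, η / 2, by positivity, fun c hc =>
      (measure_mono fun u hu => ?_).trans (h c (by simpa using hc))⟩
    obtain ⟨hu, u', hu', hd, hp⟩ := mem_ofPred.1 hu
    refine ⟨hu, mem_ofPred.2 ?_⟩
    have hcb : c ∈ closedBall (0 : multiIdx k D → ℝ) 2 := by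
      rw [mem_closedBall_zero_iff, hc]
      norm_num
    have := hη' (c, u') ⟨hcb, hu'⟩ (c, u) ⟨hcb, hu⟩ (by
      rw [Prod.dist_eq, dist_self, max_eq_right dist_nonneg]
      linarith)
    rw [Real.dist_eq] at this
    have h3 := abs_sub_abs_le_abs_sub (polyFun c u) (polyFun c u')
    rw [abs_sub_comm] at h3
    simp only at this
    linarith
  refine (isCompact_sphere (0 : multiIdx k D → ℝ) 1).induction_on
    (p := fun S => ∃ ε : ℝ, 0 < ε ∧ ∀ c ∈ S, volume (B ∩ {u | |polyFun c u| ≤ ε}) ≤ δ)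
    ⟨1, one_pos, by simp⟩ ?_ ?_ ?_
  · rintro S T hST ⟨ε, hε, h⟩
    exact ⟨ε, hε, fun c hc => h c (hST hc)⟩
  · rintro S T ⟨ε, hε, h⟩ ⟨ε', hε', h'⟩
    refine ⟨min ε ε', lt_min hε hε', ?_⟩
    rintro c (hc | hc)
    · refine (measure_mono (inter_subset_inter_right _ fun u hu => ?_)).trans (h c hc)
      exact mem_ofPred.2 ((mem_ofPred.1 hu).trans (min_le_left _ _))
    · refine (measure_mono (inter_subset_inter_right _ fun u hu => ?_)).trans (h' c hc)
      exact mem_ofPred.2 ((mem_ofPred.1 hu).trans (min_le_right _ _))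
  · intro c₀ hc₀
    rw [mem_sphere_zero_iff_norm] at hc₀
    have hmeas (n : ℕ) : MeasurableSet (B ∩ {u | |polyFun c₀ u| ≤ 1 / (n + 1 : ℝ)}) := by
      have hcont : Continuous (polyFun c₀) :=
        continuous_polyFun.comp (continuous_const.prodMk continuous_id)
      exact (isClosed_closedBall.inter (isClosed_le hcont.abs continuous_const)).measurableSet
    have hlim := tendsto_measure_iInter_atTop (μ := volume)
      (s := fun n : ℕ => B ∩ {u | |polyFun c₀ u| ≤ 1 / (n + 1 : ℝ)})
      (fun n => (hmeas n).nullMeasurableSet)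
      (fun n m hnm => inter_subset_inter_right _ fun u hu => mem_ofPred.2
        ((mem_ofPred.1 hu).trans (by gcongr)))
      ⟨0, ((measure_mono inter_subset_left).trans_lt hBc.measure_lt_top).ne⟩
    have h0 : volume (⋂ n : ℕ, B ∩ {u | |polyFun c₀ u| ≤ 1 / (n + 1 : ℝ)}) = 0 := by
      refine measure_mono_null (fun u hu => ?_)
        (volume_polyFun_zero (c := c₀) (by rintro rfl; simp at hc₀))
      rw [mem_iInter] at hu
      have h1 : |polyFun c₀ u| ≤ 0 :=
        ge_of_tendsto' tendsto_one_div_add_atTop_nhds_zero_nat fun n => mem_ofPred.1 (hu n).2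
      exact mem_ofPred.2 (abs_eq_zero.1 (le_antisymm h1 (abs_nonneg _)))
    rw [h0] at hlim
    obtain ⟨n, hn⟩ := (hlim.eventually (ge_mem_nhds hδ)).exists
    set ε : ℝ := 1 / (n + 1 : ℝ) with hε
    have hε0 : 0 < ε := by positivity
    obtain ⟨η, hη, hη'⟩ := huc (ε / 2) (by positivity)
    refine ⟨ball c₀ (min η 1), mem_nhdsWithin_of_mem_nhds (ball_mem_nhds _ (by positivity)),
      ε / 2, by positivity, fun c hc => le_trans (measure_mono fun u hu => ?_) hn⟩
    refine ⟨hu.1, mem_ofPred.2 ?_⟩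
    have hc' := lt_min_iff.1 (mem_ball.1 hc)
    have hb0 : c₀ ∈ closedBall (0 : multiIdx k D → ℝ) 2 := by
      rw [mem_closedBall_zero_iff, hc₀]
      norm_num
    have hb1 : c ∈ closedBall (0 : multiIdx k D → ℝ) 2 := by
      rw [mem_closedBall]
      have h1 := dist_triangle c c₀ 0
      rw [dist_zero_right c₀, hc₀] at h1
      linarith [hc'.2]
    have := hη' (c, u) ⟨hb1, hu.1⟩ (c₀, u) ⟨hb0, hu.1⟩ (by
      rw [Prod.dist_eq, dist_self, max_eq_left dist_nonneg]
      exact hc'.1)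
    have h2 := mem_ofPred.1 hu.2
    rw [Real.dist_eq, abs_sub_comm] at this
    have h3 := abs_sub_abs_le_abs_sub (polyFun c₀ u) (polyFun c u)
    simp only at this
    linarith

lemma abs_dotProduct_le {d : ℕ} (w y : Fin d → ℝ) : |w ⬝ᵥ y| ≤ d * (‖w‖ * ‖y‖) := by
  refine (Finset.abs_sum_le_sum_abs _ _).trans ?_
  refine (Finset.sum_le_card_nsmul _ _ (‖w‖ * ‖y‖) fun i _ => ?_).trans (by simp)
  rw [abs_mul]
  exact mul_le_mul (norm_le_pi_norm w i) (norm_le_pi_norm y i) (abs_nonneg _) (norm_nonneg _)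

/-- At points close to a nondegenerate point, every linear functional is bounded from below on the
partial derivatives of positive order. -/
lemma exists_le_abs_dotProduct_mderiv {k d D : ℕ} (hd : 1 ≤ d)
    {Φ : (Fin k → ℝ) → (Fin d → ℝ)} (hΦ : ContDiff ℝ (⊤ : ℕ∞) Φ) (v : Fin k → ℝ)
    (hspan : Submodule.span ℝ {y : Fin d → ℝ | ∃ α : Fin k → ℕ,
      0 < (∑ j, α j) ∧ (∑ j, α j) ≤ D ∧ y = mderiv α Φ v} = ⊤) :
    ∃ c : ℝ, 0 < c ∧ ∃ r : ℝ, 0 < r ∧ ∀ x ∈ closedBall v r, ∀ w : Fin d → ℝ,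
      ∃ α ∈ multiIdx k D, 0 < ∑ j, α j ∧ c * ‖w‖ ≤ |taylorCoef α * (w ⬝ᵥ mderiv α Φ x)| := by
  let G : (Fin k → ℝ) × (Fin d → ℝ) → multiIdx k D → ℝ := fun z α =>
    if 0 < ∑ j, α.1 j then taylorCoef α.1 * (z.2 ⬝ᵥ mderiv α.1 Φ z.1) else 0
  have hG : Continuous G := by
    refine continuous_pi fun α => ?_
    have hcont : Continuous (mderiv α.1 Φ) := (contDiff_mderiv hΦ α.1).continuous
    simp only [G, dotProduct]
    split_ifs
    · fun_prop
    · fun_prop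
  have hG0 (w : Fin d → ℝ) (hw : G (v, w) = 0) : w = 0 := by
    have h1 : Submodule.span ℝ {y : Fin d → ℝ | ∃ α : Fin k → ℕ,
        0 < (∑ j, α j) ∧ (∑ j, α j) ≤ D ∧ y = mderiv α Φ v} ≤
        LinearMap.ker (dotProductBilin ℝ ℝ w) := by
      refine Submodule.span_le.2 fun y hy => ?_
      obtain ⟨α, hα0, hαD, rfl⟩ := mem_ofPred.1 hy
      have h2 := congrFun hw ⟨α, mem_multiIdx.2 hαD⟩
      simp only [G, if_pos hα0, Pi.zero_apply, mul_eq_zero, (taylorCoef_pos α).ne', false_or] at h2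
      exact h2
    rw [hspan] at h1
    exact dotProduct_self_eq_zero.1 (h1 (Submodule.mem_top (x := w)))
  have : Nontrivial (Fin d → ℝ) := by
    have : Nonempty (Fin d) := ⟨⟨0, hd⟩⟩
    infer_instance
  have hsc := isCompact_sphere (0 : Fin d → ℝ) 1
  obtain ⟨w₀, hw₀, hmin⟩ := hsc.exists_isMinOn (NormedSpace.sphere_nonempty.2 zero_le_one)
    (f := fun w => ‖G (v, w)‖) (by fun_prop)
  have hpos : 0 < ‖G (v, w₀)‖ := by
    refine norm_pos_iff.2 fun h => ?_
    rw [hG0 w₀ h] at hw₀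
    simp at hw₀
  set c := ‖G (v, w₀)‖ / 2 with hc
  have huc := ((isCompact_closedBall v 1).prod hsc).uniformContinuousOn_of_continuous
    hG.continuousOn
  rw [Metric.uniformContinuousOn_iff] at huc
  obtain ⟨η, hη, h⟩ := huc c (by positivity)
  refine ⟨c, by positivity, min (η / 2) 1, by positivity, fun x hx w => ?_⟩
  have key (w : Fin d → ℝ) (hw : ‖w‖ = 1) : c ≤ ‖G (x, w)‖ := by
    have hws : w ∈ sphere (0 : Fin d → ℝ) 1 := by simpa using hw
    have hx' := le_min_iff.1 (mem_closedBall.1 hx)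
    have h1 := h (x, w) ⟨hx'.2, hws⟩ (v, w) ⟨mem_closedBall_self zero_le_one, hws⟩ (by
      rw [Prod.dist_eq, dist_self, max_eq_left dist_nonneg]
      linarith [hx'.1])
    rw [dist_comm, dist_eq_norm] at h1
    have h2 := norm_sub_norm_le (G (v, w)) (G (x, w))
    have h3 : ‖G (v, w₀)‖ ≤ ‖G (v, w)‖ := hmin hws
    linarith
  have hsm (t : ℝ) (w : Fin d → ℝ) : G (x, t • w) = t • G (x, w) := by
    ext α
    simp only [G, Pi.smul_apply, smul_dotProduct, smul_eq_mul]
    split_ifs <;> ring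
  have key2 : c * ‖w‖ ≤ ‖G (x, w)‖ := by
    rcases eq_or_ne w 0 with rfl | hw
    · simp
    · have h1 := key (‖w‖⁻¹ • w) (norm_smul_inv_norm hw)
      rw [hsm, norm_smul, norm_inv, norm_norm, inv_mul_eq_div, le_div_iff₀ (norm_pos_iff.2 hw)] at h1
      exact h1
  rcases eq_or_ne w 0 with rfl | hw
  · have hne : ∃ α ∈ multiIdx k D, 0 < ∑ j, α j := by
      have h1 := key w₀ (by simpa using hw₀)
      by_contra! hcon
      have : G (x, w₀) = 0 := by
        ext α
        simp [G, Nat.le_zero.1 (hcon α.1 α.2)]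
      rw [this, norm_zero] at h1
      linarith
    obtain ⟨α, hα, h0⟩ := hne
    exact ⟨α, hα, h0, by simp⟩
  · have hpos2 : 0 < c * ‖w‖ := mul_pos (by positivity) (norm_pos_iff.2 hw)
    by_contra! hcon
    refine key2.not_gt ((pi_norm_lt_iff hpos2).2 fun α => ?_)
    simp only [G]
    split_ifs with h0
    · exact hcon α.1 α.2 h0
    · simpa using hpos2

/-- The points of the grid `{0, 1/m, …, (m-1)/m}^k`. -/
def gridPt {k m : ℕ} (j : Fin k → Fin m) : Fin k → ℝ := fun i => (j i : ℝ) / m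

lemma norm_gridPt_le {k m : ℕ} (hm : 1 ≤ m) (j : Fin k → Fin m) : ‖gridPt j‖ ≤ 1 - 1 / m := by
  have hm0 : (1 : ℝ) ≤ m := by exact_mod_cast hm
  have h0 : 0 ≤ 1 - 1 / (m : ℝ) := sub_nonneg.2 (div_le_one_of_le₀ hm0 (by positivity))
  refine (pi_norm_le_iff_of_nonneg h0).2 fun i => ?_
  have h1 : ((j i : ℕ) : ℝ) + 1 ≤ m := by exact_mod_cast (j i).2
  rw [gridPt, Real.norm_of_nonneg (by positivity), le_sub_iff_add_le, ← add_div]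
  exact div_le_one_of_le₀ h1 (Nat.cast_nonneg _)

lemma le_dist_gridPt {k m : ℕ} {j j' : Fin k → Fin m} (h : j ≠ j') :
    1 / (m : ℝ) ≤ dist (gridPt j) (gridPt j') := by
  obtain ⟨i, hi⟩ := Function.ne_iff.1 h
  refine le_trans ?_ (dist_le_pi_dist _ _ i)
  rw [gridPt, gridPt, Real.dist_eq, ← sub_div, abs_div, Nat.abs_cast]
  gcongr
  have h1 : ((j i : ℕ) : ℤ) - ((j' i : ℕ) : ℤ) ≠ 0 := by
    rw [sub_ne_zero]
    exact_mod_cast fun h => hi (Fin.ext h)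
  exact_mod_cast Int.one_le_abs h1

/-- If the `1/(2m)`-balls around a set of grid points are contained in a set of volume at most
`1/2`, then there are at most `m^k/2` such points. -/
lemma card_le_of_volume_le {k m : ℕ} (hm : 1 ≤ m) (J : Finset (Fin k → Fin m))
    (S : Set (Fin k → ℝ)) (hS : volume S ≤ ENNReal.ofReal (1 / 2))
    (hJ : ∀ j ∈ J, ball (gridPt j) (1 / (2 * m)) ⊆ S) : 2 * J.card ≤ m ^ k := by
  have hm0 : (0 : ℝ) < m := by exact_mod_cast hm
  have h1 : volume (⋃ j ∈ J, ball (gridPt j) (1 / (2 * m : ℝ))) =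
      ∑ j ∈ J, volume (ball (gridPt j) (1 / (2 * m : ℝ))) := by
    refine measure_biUnion_finset (fun j _ j' _ hjj => ball_disjoint_ball ?_)
      fun j _ => measurableSet_ball
    refine le_trans (le_of_eq ?_) (le_dist_gridPt hjj)
    field_simp
    norm_num
  have h2 (j : Fin k → Fin m) : volume (ball (gridPt j) (1 / (2 * m : ℝ))) =
      ENNReal.ofReal ((1 / m) ^ k) := by
    rw [Real.volume_pi_ball _ (by positivity), Fintype.card_fin]
    congr 2
    field_simp
  have h3 := (h1.symm.le.trans (measure_mono (iUnion₂_subset hJ))).trans hS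
  simp only [h2, Finset.sum_const, nsmul_eq_mul] at h3
  rw [← ENNReal.ofReal_natCast, ← ENNReal.ofReal_mul (Nat.cast_nonneg _),
    ENNReal.ofReal_le_ofReal_iff (by norm_num)] at h3
  rw [one_div, inv_pow, ← div_eq_mul_inv, div_le_iff₀ (by positivity)] at h3
  have : (2 * J.card : ℝ) ≤ m ^ k := by linarith
  exact_mod_cast this

/-- At small scales near a nondegenerate point, the preimage of an affine hyperplane meets at most
half of the cells of a fine grid. -/
lemma exists_card_cells_le {k d D : ℕ} (hd : 1 ≤ d)
    {Φ : (Fin k → ℝ) → (Fin d → ℝ)} (hΦ : ContDiff ℝ (⊤ : ℕ∞) Φ) (v : Fin k → ℝ)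
    (hspan : Submodule.span ℝ {y : Fin d → ℝ | ∃ α : Fin k → ℕ,
      0 < (∑ j, α j) ∧ (∑ j, α j) ≤ D ∧ y = mderiv α Φ v} = ⊤) :
    ∃ m₀ : ℕ, 1 ≤ m₀ ∧ ∃ r : ℝ, 0 < r ∧ r ≤ 1 ∧ ∀ m : ℕ, m₀ ≤ m → ∀ x ∈ closedBall v r,
      ∀ ρ : ℝ, 0 < ρ → ρ ≤ r → ∀ (b : ℝ) (w : Fin d → ℝ), w ≠ 0 →
      ∀ J : Finset (Fin k → Fin m), (∀ j ∈ J, ∃ y ∈ closedBall (x + ρ • gridPt j) (ρ / (2 * m)),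
        b + ∑ i, w i * Φ y i = 0) → 2 * J.card ≤ m ^ k := by
  obtain ⟨c₀, hc₀, r₀, hr₀, hlow⟩ := exists_le_abs_dotProduct_mderiv hd hΦ v hspan
  obtain ⟨C, hC, hT⟩ := exists_taylor_bound hΦ v D
  obtain ⟨ε, hε, η, hη, hvol⟩ := exists_volume_sublevel_le k D
    (δ := ENNReal.ofReal (1 / 2)) (by simp)
  set r₁ : ℝ := ε * c₀ / (d * C * 2 ^ (D + 1)) with hr₁
  have hd0 : (0 : ℝ) < d := by exact_mod_cast hd
  have hr₁0 : 0 < r₁ := by positivity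
  refine ⟨⌈1 / η⌉₊ + 1, by omega, min (min r₀ r₁) (1 / 2), by positivity,
    (min_le_right _ _).trans (by norm_num), ?_⟩
  intro m hm x hx ρ hρ0 hρ b w hw J hJ
  simp only [le_min_iff, mem_closedBall] at hx hρ
  have hm1 : 1 ≤ m := by omega
  have hm0 : (0 : ℝ) < m := by exact_mod_cast hm1
  have hmη : 1 / (m : ℝ) ≤ η := by
    rw [div_le_iff₀ hm0, mul_comm, ← div_le_iff₀ hη]
    exact (Nat.le_ceil _).trans (by exact_mod_cast (by omega : ⌈1 / η⌉₊ ≤ m))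
  have hm2 : 1 / (2 * m : ℝ) ≤ 1 / 2 := by
    have : (1 : ℝ) ≤ m := by exact_mod_cast hm1
    gcongr
    linarith
  let c' : multiIdx k D → ℝ := fun α =>
    ρ ^ (∑ j, α.1 j) * (taylorCoef α.1 * (w ⬝ᵥ mderiv α.1 Φ x)) + if α.1 = 0 then b else 0
  set s := ‖c'‖ with hs
  have hsw : c₀ * ρ ^ D * ‖w‖ ≤ s := by
    obtain ⟨α, hα, hα0, hle⟩ := hlow x (mem_closedBall.2 hx.1.1) w
    have hα0' : α ≠ 0 := by
      rintro rfl
      simp at hα0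
    have h1 := norm_le_pi_norm c' ⟨α, hα⟩
    simp only [c', if_neg hα0', add_zero, norm_mul, norm_pow, Real.norm_of_nonneg hρ0.le] at h1
    refine le_trans ?_ h1
    rw [← norm_mul, Real.norm_eq_abs, mul_right_comm, mul_comm]
    have hp : ρ ^ D ≤ ρ ^ ∑ j, α j :=
      pow_le_pow_of_le_one hρ0.le (by linarith [hρ.2]) (mem_multiIdx.1 hα)
    exact mul_le_mul hp hle (by positivity) (by positivity)
  have hs0 : 0 < s := lt_of_lt_of_le (by have := norm_pos_iff.2 hw; positivity) hsw
  have hpoly (u : Fin k → ℝ) (hu : ‖u‖ ≤ 2) (h0 : b + ∑ i, w i * Φ (x + ρ • u) i = 0) :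
      |polyFun (s⁻¹ • c') u| ≤ ε := by
    have hρu : ‖ρ • u‖ ≤ 2 * ρ := by
      rw [norm_smul, Real.norm_of_nonneg hρ0.le]
      nlinarith
    have h1 := hT x (mem_closedBall.2 (hx.2.trans (by norm_num))) (ρ • u)
      (hρu.trans (by linarith [hρ.2]))
    set T := ∑ α ∈ multiIdx k D, (∏ i, (ρ • u) i ^ α i) • (taylorCoef α • mderiv α Φ x) with hTdef
    have h2 : polyFun c' u = b + w ⬝ᵥ T := by
      rw [hTdef, dotProduct_sum, polyFun, ← Finset.sum_coe_sort (multiIdx k D)]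
      have h3 : b = ∑ α : multiIdx k D, (if α.1 = 0 then b else 0) * ∏ i, u i ^ α.1 i := by
        rw [Finset.sum_eq_single ⟨0, mem_multiIdx.2 (by simp)⟩]
        · simp
        · intro α _ hα
          rw [if_neg fun h => hα (Subtype.ext h), zero_mul]
        · simp
      conv_rhs => rw [h3]
      rw [← Finset.sum_add_distrib]
      refine Finset.sum_congr rfl fun α _ => ?_
      simp only [c', dotProduct_smul, Pi.smul_apply, smul_eq_mul, mul_pow, Finset.prod_mul_distrib,
        Finset.prod_pow_eq_pow_sum]
      ring
    have h3 : polyFun c' u = -(w ⬝ᵥ (Φ (x + ρ • u) - T)) := by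
      rw [h2, dotProduct_sub]
      have : w ⬝ᵥ Φ (x + ρ • u) = -b := by
        rw [dotProduct]
        linarith
      rw [this]
      ring
    have h4 : polyFun (s⁻¹ • c') u = s⁻¹ * polyFun c' u := by
      simp only [polyFun, Pi.smul_apply, smul_eq_mul, Finset.mul_sum, mul_assoc]
    have hw0 := norm_pos_iff.2 hw
    have h5 : |polyFun c' u| ≤ d * (‖w‖ * (C * (2 * ρ) ^ (D + 1))) := by
      rw [h3, abs_neg]
      refine (abs_dotProduct_le _ _).trans ?_
      gcongr
      exact h1.trans (by gcongr)
    rw [h4, abs_mul, abs_inv, abs_of_pos hs0, inv_mul_le_iff₀ hs0]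
    refine h5.trans (le_trans ?_ (mul_le_mul_of_nonneg_right hsw hε.le))
    have h6 : ρ * (d * C * 2 ^ (D + 1)) ≤ ε * c₀ := by
      rw [← le_div_iff₀ (by positivity)]
      exact hρ.1.2
    calc d * (‖w‖ * (C * (2 * ρ) ^ (D + 1)))
        = (ρ ^ D * ‖w‖) * (ρ * (d * C * 2 ^ (D + 1))) := by ring
      _ ≤ (ρ ^ D * ‖w‖) * (ε * c₀) := by gcongr
      _ = c₀ * ρ ^ D * ‖w‖ * ε := by ring
  refine card_le_of_volume_le hm1 J _ (hvol (s⁻¹ • c') (norm_smul_inv_norm (norm_pos_iff.1 hs0))) ?_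
  intro j hj u hu
  obtain ⟨y, hy, hy0⟩ := hJ j hj
  set u' : Fin k → ℝ := ρ⁻¹ • (y - x) with hu'
  have hyu : y = x + ρ • u' := by
    rw [hu', smul_inv_smul₀ hρ0.ne']
    abel
  have hdist : dist u' (gridPt j) ≤ 1 / (2 * m) := by
    rw [mem_closedBall, hyu, dist_add_left, dist_smul₀, Real.norm_of_nonneg hρ0.le] at hy
    refine le_of_mul_le_mul_left (hy.trans_eq ?_) hρ0
    ring
  have hz : ‖gridPt j‖ ≤ 1 := (norm_gridPt_le hm1 j).trans (sub_le_self _ (by positivity))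
  rw [mem_ball] at hu
  have hball (z : Fin k → ℝ) (hz' : dist z (gridPt j) ≤ 1 / (2 * m)) : ‖z‖ ≤ 2 := by
    have h1 := dist_triangle z (gridPt j) 0
    rw [dist_zero_right, dist_zero_right] at h1
    linarith
  refine mem_ofPred.2 ⟨mem_closedBall_zero_iff.2 (hball u hu.le), u',
    mem_closedBall_zero_iff.2 (hball u' hdist), ?_, hpoly u' (hball u' hdist) (hyu ▸ hy0)⟩
  have h1 := dist_triangle_right u' u (gridPt j)
  have h2 : 1 / (2 * m : ℝ) + 1 / (2 * m) = 1 / m := by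
    field_simp
    norm_num
  linarith

lemma exists_mul_rpow_ge {k : ℕ} {s : ℝ} (hs : s < k) (m₀ : ℕ) :
    ∃ m : ℕ, m₀ ≤ m ∧ 1 ≤ m ∧ 1 ≤ (m ^ k / 2 : ℝ) * (1 / (4 * m) : ℝ) ^ s := by
  have h1 : Tendsto (fun m : ℕ => (m : ℝ) ^ ((k : ℝ) - s)) atTop atTop :=
    (tendsto_rpow_atTop (sub_pos.2 hs)).comp tendsto_natCast_atTop_atTop
  obtain ⟨m, hm, hmm⟩ :=
    ((h1.eventually_ge_atTop (2 * 4 ^ s)).and (eventually_ge_atTop (m₀ + 1))).exists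
  have hm0 : (0 : ℝ) < m := by exact_mod_cast (by omega : 0 < m)
  refine ⟨m, by omega, by omega, ?_⟩
  rw [Real.rpow_sub hm0, Real.rpow_natCast, le_div_iff₀ (by positivity)] at hm
  rw [Real.div_rpow zero_le_one (by positivity), Real.one_rpow,
    Real.mul_rpow (by norm_num) hm0.le, div_mul_div_comm, mul_one, le_div_iff₀ (by positivity)]
  linarith

/-- In the parameter space there are large sets of points that are badly approximable by
parameters of rational points. -/
lemma exists_badly_approximable_set {k d D : ℕ} (hk : 1 ≤ k) (hkd : k ≤ d)
    {Φ : (Fin k → ℝ) → (Fin d → ℝ)} (hΦ : ContDiff ℝ (⊤ : ℕ∞) Φ) (v : Fin k → ℝ)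
    (hspan : Submodule.span ℝ {y : Fin d → ℝ | ∃ α : Fin k → ℕ,
      0 < (∑ j, α j) ∧ (∑ j, α j) ≤ D ∧ y = mderiv α Φ v} = ⊤)
    {s : ℝ≥0} (hs0 : 0 < s) (hs : (s : ℝ) < k) {r : ℝ} (hr : 0 < r) :
    ∃ A ⊆ closedBall v r, (s : ℝ≥0∞) ≤ dimH A ∧ ∀ a ∈ A, ∃ κ : ℝ, 0 < κ ∧
      ∀ y, IsRatPt (Φ y) → κ * (ht (Φ y) : ℝ) ^ (-ckd k d) ≤ dist a y := by
  classical
  set c := ckd k d with hc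
  have hc0 : 0 < c := ckd_pos hk hkd
  obtain ⟨κ, hκ, hsimp⟩ := exists_hyperplane_of_ht_le hk hkd hΦ v
  obtain ⟨m₀, hm₀, r₀, hr₀, hr₀1, hcount⟩ := exists_card_cells_le (hk.trans hkd) hΦ v hspan
  obtain ⟨m, hmm, hm1, hms⟩ := exists_mul_rpow_ge hs m₀
  have hm0 : (1 : ℝ) ≤ m := by exact_mod_cast hm1
  set ρ₀ := min (min r₀ r) (1 / 2) with hρ₀
  have hρ₀0 : 0 < ρ₀ := by positivity
  have hρ₀r : ρ₀ ≤ r := (min_le_left _ _).trans (min_le_right _ _)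
  have hρ₀r₀ : ρ₀ ≤ r₀ := (min_le_left _ _).trans (min_le_left _ _)
  have hρ₀1 : ρ₀ ≤ 1 / 2 := min_le_right _ _
  set β : ℝ := 1 / (4 * m) with hβ
  have hβ0 : 0 < β := by positivity
  have hβ1 : β < 1 := by
    rw [hβ, div_lt_one (by positivity)]
    linarith
  set N := m ^ k - m ^ k / 2 with hN
  have hNm : (m ^ k / 2 : ℝ) ≤ N := by
    have : m ^ k ≤ 2 * N := by omega
    have : (m ^ k : ℝ) ≤ 2 * N := by exact_mod_cast this
    linarith
  have hNβ : 1 ≤ N * β ^ (s : ℝ) := hms.trans (by gcongr)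
  have hN1 : 1 < N := by
    have h1 : β ^ (s : ℝ) < 1 := Real.rpow_lt_one hβ0.le hβ1 (by exact_mod_cast hs0)
    by_contra! h
    have h2 : (N : ℝ) ≤ 1 := by exact_mod_cast h
    have h3 : 0 < β ^ (s : ℝ) := by positivity
    nlinarith
  let R : ℕ → ℝ := fun n => 2 * (β ^ n * ρ₀)
  have hR0 (n) : 0 < R n := by positivity
  have hβn (n : ℕ) : β ^ n ≤ 1 := pow_le_one₀ hβ0.le hβ1.le
  obtain ⟨A, hA, hAP⟩ := exists_cantor_set hN1 hβ0 hβ1 hs0 hNβ v hρ₀0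
    (fun n x y => ∀ z ∈ closedBall x (R n), IsRatPt (Φ z) →
      (ht (Φ z) : ℝ) ≤ κ * R n ^ (-(1 / c)) → R (n + 1) ≤ dist z y) (by
    intro n x hx
    set ρ := β ^ n * ρ₀ with hρ
    have hρ0 : 0 < ρ := by positivity
    have hρρ₀ : ρ ≤ ρ₀ := mul_le_of_le_one_left hρ₀0.le (hβn n)
    have hxv := mem_closedBall.1 (hx (mem_closedBall_self hρ0.le))
    obtain ⟨b, w, hw, hbw⟩ := hsimp x (mem_closedBall.2 (by linarith)) (2 * ρ) (by positivity)
      (by linarith)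
    let J : Finset (Fin k → Fin m) := Finset.univ.filter fun j =>
      ∃ y ∈ closedBall (x + ρ • gridPt j) (ρ / (2 * m)), b + ∑ i, w i * Φ y i = 0
    have hJ : 2 * J.card ≤ m ^ k := hcount m hmm x (mem_closedBall.2 (by linarith)) ρ hρ0
      (by linarith) b w hw J fun j hj => (Finset.mem_filter.1 hj).2
    have hJc : Fintype.card (Fin N) ≤ Jᶜ.card := by
      rw [Finset.card_compl, Fintype.card_fun, Fintype.card_fin, Fintype.card_fin, Fintype.card_fin]
      omega
    obtain ⟨e⟩ : Nonempty (Fin N ↪ (Jᶜ : Finset (Fin k → Fin m))) :=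
      Function.Embedding.nonempty_of_card_le (by rwa [Fintype.card_coe])
    have hρβ : β ^ (n + 1) * ρ₀ = ρ / (4 * m) := by
      rw [hρ, hβ]
      ring
    refine ⟨fun i => x + ρ • gridPt (e i).1, fun i => ⟨?_, ?_⟩, fun i j hij => ?_⟩
    · refine closedBall_subset_closedBall' ?_
      have h1 := norm_gridPt_le hm1 (e i).1
      rw [dist_self_add_left, norm_smul, Real.norm_of_nonneg hρ0.le, hρβ]
      have h2 : ρ / (4 * m) ≤ ρ / m := by
        gcongr
        linarith
      have h3 : ρ * ‖gridPt (e i).1‖ ≤ ρ * (1 - 1 / m) := by gcongr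
      have h4 : ρ * (1 - 1 / m) = ρ - ρ / m := by ring
      linarith
    · intro z hz hrat hht
      have h0 := hbw z hz hrat hht
      have hj : (e i).1 ∉ J := Finset.mem_compl.1 (e i).2
      by_contra! hlt
      refine hj (Finset.mem_filter.2 ⟨Finset.mem_univ _, z, mem_closedBall.2 ?_, h0⟩)
      refine hlt.le.trans_eq ?_
      simp only [R, hρβ]
      field_simp
      norm_num
    · have h1 := le_dist_gridPt (j := (e i).1) (j' := (e j).1)
        fun h => hij (e.injective (Subtype.ext h))
      rw [dist_add_left, dist_smul₀, Real.norm_of_nonneg hρ0.le, hρβ]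
      calc 4 * (ρ / (4 * m)) = ρ * (1 / m) := by
            field_simp
        _ ≤ _ := by gcongr)
  refine ⟨A, fun a ha => ?_, hA, fun a ha => ?_⟩
  · obtain ⟨x, hx⟩ := hAP a ha
    exact closedBall_subset_closedBall hρ₀r ((hx 0).2.1 (hx 0).1)
  · obtain ⟨x, hx⟩ := hAP a ha
    refine ⟨min (β * ρ₀) (β ^ 2 * κ ^ c / 2), by positivity, fun z hz => ?_⟩
    have hH : (1 : ℝ) ≤ ht (Φ z) := by exact_mod_cast hz.ht_pos
    have hlim : Tendsto (fun n => κ * R n ^ (-(1 / c))) atTop atTop := by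
      refine Tendsto.const_mul_atTop hκ ?_
      refine (tendsto_rpow_neg_nhdsGT_zero (neg_lt_zero.2 (by positivity))).comp ?_
      refine tendsto_nhdsWithin_iff.2 ⟨?_, Eventually.of_forall hR0⟩
      have := ((tendsto_pow_atTop_nhds_zero_of_lt_one hβ0.le hβ1).mul_const ρ₀).const_mul 2
      simpa using this
    have hex : ∃ n, (ht (Φ z) : ℝ) ≤ κ * R n ^ (-(1 / c)) :=
      (hlim.eventually_ge_atTop _).exists
    obtain ⟨n, hn, hmin⟩ : ∃ n, (ht (Φ z) : ℝ) ≤ κ * R n ^ (-(1 / c)) ∧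
        ∀ l < n, ¬ (ht (Φ z) : ℝ) ≤ κ * R l ^ (-(1 / c)) :=
      ⟨Nat.find hex, Nat.find_spec hex, fun l hl => Nat.find_min hex hl⟩
    have hd : β ^ (n + 1) * ρ₀ ≤ dist a z := by
      by_cases hzn : z ∈ closedBall (x n) (R n)
      · have h1 := (hx n).2.2 z hzn hz hn
        have h2 := mem_closedBall.1 (hx (n + 1)).1
        have h3 := dist_triangle_left z (x (n + 1)) a
        simp only [R] at h1
        linarith
      · rw [mem_closedBall, not_le] at hzn
        have h2 := mem_closedBall.1 (hx n).1
        have h3 := dist_triangle_left z (x n) a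
        have h4 : β ^ (n + 1) * ρ₀ ≤ β ^ n * ρ₀ := by
          gcongr ?_ * _
          exact pow_le_pow_of_le_one hβ0.le hβ1.le (Nat.le_succ n)
        simp only [R] at hzn
        linarith
    have hHc : 0 < (ht (Φ z) : ℝ) ^ (-c) := by positivity
    refine le_trans ?_ hd
    rcases n with _ | n
    · have h1 : (ht (Φ z) : ℝ) ^ (-c) ≤ 1 := Real.rpow_le_one_of_one_le_of_nonpos hH (by linarith)
      calc _ ≤ (β * ρ₀) * 1 := by
            gcongr
            exact min_le_left _ _
        _ = _ := by ring
    · have h1 := (not_le.1 (hmin n (Nat.lt_succ_self n))).le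
      have h2 := Real.rpow_le_rpow_of_nonpos (by positivity) h1 (neg_nonpos.2 hc0.le)
      rw [Real.mul_rpow hκ.le (by positivity), ← Real.rpow_mul (hR0 n).le,
        show -(1 / c) * -c = 1 by field_simp, Real.rpow_one, Real.rpow_neg hκ.le,
        le_inv_mul_iff₀ (by positivity)] at h2
      calc _ ≤ (β ^ 2 * κ ^ c / 2) * (ht (Φ z) : ℝ) ^ (-c) := by
            gcongr
            exact min_le_right _ _
        _ = β ^ 2 / 2 * (κ ^ c * (ht (Φ z) : ℝ) ^ (-c)) := by ring
        _ ≤ β ^ 2 / 2 * R n := by gcongr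
        _ = _ := by simp only [R]; ring

lemma multiD_congr {ι : Type*} [Fintype ι] {E F : Type*} [NormedAddCommGroup E] [NormedSpace ℝ E]
    [NormedAddCommGroup F] [NormedSpace ℝ F] (e : ι → E) (α : ι → ℕ) {f g : E → F} {x : E}
    (h : f =ᶠ[𝓝 x] g) : multiD e α f =ᶠ[𝓝 x] multiD e α g := by
  have h1 (v : E) {f g : E → F} (h : f =ᶠ[𝓝 x] g) : dirD v f =ᶠ[𝓝 x] dirD v g :=
    h.fderiv.mono fun y hy => by rw [dirD, dirD, hy]
  have h2 (v : E) (n : ℕ) {f g : E → F} (h : f =ᶠ[𝓝 x] g) :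
      (dirD v)^[n] f =ᶠ[𝓝 x] (dirD v)^[n] g := by
    induction n with
    | zero => exact h
    | succ n ih =>
      rw [Function.iterate_succ_apply', Function.iterate_succ_apply']
      exact h1 v ih
  unfold multiD
  induction (Finset.univ : Finset ι).toList with
  | nil => exact h
  | cons i l ih => exact h2 _ _ ih

/-- A smooth map on an open set agrees near any given point with a globally smooth map. -/
lemma exists_contDiff_extension {E F : Type*} [NormedAddCommGroup E] [NormedSpace ℝ E]
    [FiniteDimensional ℝ E] [NormedAddCommGroup F] [NormedSpace ℝ F] {U : Set E} (hU : IsOpen U)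
    {Φ : E → F} (hΦ : ContDiffOn ℝ (⊤ : ℕ∞) Φ U) {v : E} (hv : v ∈ U) :
    ∃ Ψ : E → F, ContDiff ℝ (⊤ : ℕ∞) Ψ ∧ ∃ r : ℝ, 0 < r ∧ ball v r ⊆ U ∧
      ∀ y ∈ ball v r, Ψ y = Φ y := by
  obtain ⟨R, hR, hRU⟩ := Metric.isOpen_iff.1 hU v hv
  let f : ContDiffBump v := ⟨R / 4, R / 2, by positivity, by linarith⟩
  refine ⟨fun y => f y • Φ y, contDiff_iff_contDiffAt.2 fun y => ?_, R / 4, by positivity,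
    (ball_subset_ball (by linarith)).trans hRU, fun y hy => ?_⟩
  · by_cases hy : y ∈ ball v R
    · exact f.contDiff.contDiffAt.smul (hΦ.contDiffAt (hU.mem_nhds (hRU hy)))
    · have hy' : y ∉ tsupport f := by
        rw [f.tsupport_eq]
        intro h
        rw [mem_closedBall] at h
        rw [mem_ball, not_lt] at hy
        have h' : dist y v ≤ R / 2 := h
        linarith
      have h0 : (fun y => f y • Φ y) =ᶠ[𝓝 y] fun _ => 0 := by
        filter_upwards [notMem_tsupport_iff_eventuallyEq.1 hy'] with z hz
        rw [hz, Pi.zero_apply, zero_smul]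
      exact contDiffAt_const.congr_of_eventuallyEq h0
  · have : f y = 1 := f.one_of_mem_closedBall (ball_subset_closedBall hy)
    simp only [this, one_smul]

/-- An immersion is locally expanding up to a constant. -/
lemma exists_le_dist_image {E F : Type*} [NormedAddCommGroup E] [NormedSpace ℝ E]
    [FiniteDimensional ℝ E] [NormedAddCommGroup F] [NormedSpace ℝ F]
    {Φ : E → F} (hΦ : ContDiff ℝ (⊤ : ℕ∞) Φ) (v : E)
    (hinj : Function.Injective (fderiv ℝ Φ v)) :
    ∃ c : ℝ, 0 < c ∧ ∃ r : ℝ, 0 < r ∧ ∀ x ∈ ball v r, ∀ y ∈ ball v r,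
      c * dist x y ≤ dist (Φ x) (Φ y) := by
  obtain ⟨K, hK, hanti⟩ := (fderiv ℝ Φ v : E →ₗ[ℝ] F).exists_antilipschitzWith
    (LinearMap.ker_eq_bot.2 hinj)
  have hst : HasStrictFDerivAt Φ (fderiv ℝ Φ v) v :=
    hΦ.contDiffAt.hasStrictFDerivAt (by simp)
  have hK0 : (0 : ℝ) < K := hK
  have hev := hst.isLittleO.def (c := 1 / (2 * K)) (by positivity)
  obtain ⟨r, hr, h⟩ := Metric.eventually_nhds_iff_ball.1 hev
  refine ⟨1 / (2 * K), by positivity, r, hr, fun x hx y hy => ?_⟩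
  have h1 := h (x, y) (by rw [← ball_prod_same]; exact ⟨hx, hy⟩)
  have h2 : ‖x - y‖ ≤ K * ‖fderiv ℝ Φ v (x - y)‖ := by
    rw [map_sub, ← dist_eq_norm, ← dist_eq_norm]
    exact hanti.le_mul_dist x y
  rw [dist_eq_norm, dist_eq_norm]
  simp only at h1
  have h3 := norm_sub_norm_le (fderiv ℝ Φ v (x - y)) (fderiv ℝ Φ v (x - y) - (Φ x - Φ y))
  rw [sub_sub_cancel, norm_sub_rev _ (Φ x - Φ y)] at h3
  have h4 : 1 / K * ‖x - y‖ ≤ ‖fderiv ℝ Φ v (x - y)‖ := by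
    rw [one_div, inv_mul_le_iff₀ hK0]
    exact h2
  have h5 : 1 / K * ‖x - y‖ = 1 / (2 * K) * ‖x - y‖ + 1 / (2 * K) * ‖x - y‖ := by
    field_simp
    norm_num
  linarith

lemma dimH_le_dimH_image {X Y : Type*} [MetricSpace X] [MetricSpace Y] {f : X → Y} {A : Set X}
    {c : ℝ} (hc : 0 < c) (h : ∀ x ∈ A, ∀ y ∈ A, c * dist x y ≤ dist (f x) (f y)) :
    dimH A ≤ dimH (f '' A) := by
  rcases A.eq_empty_or_nonempty with rfl | ⟨a₀, _⟩
  · simp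
  have : Nonempty X := ⟨a₀⟩
  have hinj : InjOn f A := fun x hx y hy hxy => by
    have h1 := h x hx y hy
    rw [hxy, dist_self] at h1
    exact dist_le_zero.1 (nonpos_of_mul_nonpos_right h1 hc)
  have hinv := hinj.leftInvOn_invFunOn
  have hlip : LipschitzOnWith (Real.toNNReal c⁻¹) (Function.invFunOn f A) (f '' A) := by
    refine LipschitzOnWith.of_dist_le_mul ?_
    rintro _ ⟨x, hx, rfl⟩ _ ⟨y, hy, rfl⟩
    rw [hinv hx, hinv hy, Real.coe_toNNReal _ (by positivity), le_inv_mul_iff₀ hc]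
    exact h x hx y hy
  have h2 := hlip.dimH_image_le
  rwa [hinv.image_image] at h2

/-- A smooth submanifold of dimension `k` has Hausdorff dimension at most `k`. -/
lemma IsSmoothSubmanifold.dimH_le {k d : ℕ} {M : Set (Fin d → ℝ)}
    (hM : IsSmoothSubmanifold k d M) : dimH M ≤ k := by
  by_contra! hlt
  obtain ⟨x, hx, hxd⟩ := exists_mem_nhdsWithin_lt_dimH_of_lt_dimH hlt
  obtain ⟨U, Φ, hΦ, v, hv, rfl⟩ := hM x hx
  obtain ⟨Ψ, hΨ, r, hr, hrU, hΨΦ⟩ := exists_contDiff_extension hΦ.open_dom hΦ.smooth hv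
  obtain ⟨O, hO, hOM⟩ := hΦ.open_map (ball v r) isOpen_ball
  rw [inter_eq_self_of_subset_left hrU] at hOM
  have h1 : Φ '' ball v r ∈ 𝓝[M] (Φ v) := by
    rw [hOM, inter_comm]
    exact inter_mem_nhdsWithin _ (hO.mem_nhds
      (hOM.subset (mem_image_of_mem Φ (mem_ball_self hr))).1)
  have h2 := hxd _ h1
  rw [← image_congr hΨΦ] at h2
  have h3 := (hΨ.of_le (m := 1) (by exact_mod_cast le_top)).contDiffOn.dimH_image_le
    (convex_ball v r) (t := ball v r) Subset.rfl
  have h4 : dimH (ball v r) ≤ k := (dimH_mono (subset_univ _)).trans (by simp [Real.dimH_univ_pi_fin])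
  exact h2.not_ge (h3.trans h4)

/-- **Theorem (full dimension of badly intrinsically approximable points).**
If `M ⊆ ℝ^d` is a nondegenerate `C^∞` submanifold of dimension `k` (`1 ≤ k ≤ d`),
then the Hausdorff dimension of `BA_M(ψ_{c(k,d)})` equals `k`. -/
theorem badly_approximable_full_dimension (k d : ℕ) (hk : 1 ≤ k) (hkd : k ≤ d)
    (M : Set (Fin d → ℝ)) (hM : IsSmoothSubmanifold k d M)
    (hnd : ∃ x ∈ M, IsNondeg k d M x) :
    dimH (BAset M (ckd k d)) = (k : ENNReal) := by
  refine le_antisymm ((dimH_mono fun x hx => (mem_ofPred.1 hx).1).trans hM.dimH_le) ?_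
  obtain ⟨-, -, D, U, Φ, v, hΦ, hv, -, hspan⟩ := hnd
  obtain ⟨Ψ, hΨ, r₁, hr₁, hrU, hΨΦ⟩ := exists_contDiff_extension hΦ.open_dom hΦ.smooth hv
  have hev : Ψ =ᶠ[𝓝 v] Φ := eventually_of_mem (ball_mem_nhds v hr₁) hΨΦ
  have hspan' : Submodule.span ℝ {y : Fin d → ℝ | ∃ α : Fin k → ℕ,
      0 < (∑ j, α j) ∧ (∑ j, α j) ≤ D ∧ y = mderiv α Ψ v} = ⊤ := by
    have h (α : Fin k → ℕ) : mderiv α Ψ v = mderiv α Φ v := (multiD_congr _ α hev).eq_of_nhds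
    simpa only [h] using hspan
  have hinj : Function.Injective (fderiv ℝ Ψ v) := by
    rw [hev.fderiv_eq]
    exact hΦ.immersion v hv
  obtain ⟨c, hc, r₂, hr₂, hexp⟩ := exists_le_dist_image hΨ v hinj
  set r := min r₁ r₂ with hr
  have hr0 : 0 < r := lt_min hr₁ hr₂
  have hrr₁ : ball v r ⊆ ball v r₁ := ball_subset_ball (min_le_left _ _)
  have hrr₂ : ball v r ⊆ ball v r₂ := ball_subset_ball (min_le_right _ _)
  obtain ⟨O, hO, hOM⟩ := hΦ.open_map (ball v r) isOpen_ball
  rw [inter_eq_self_of_subset_left (hrr₁.trans hrU),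
    ← image_congr fun y hy => hΨΦ y (hrr₁ hy)] at hOM
  refine ENNReal.le_of_forall_nnreal_lt fun s hs => ?_
  rcases eq_or_ne s 0 with rfl | hs0
  · simp
  have hsk : (s : ℝ) < k := by exact_mod_cast hs
  obtain ⟨A, hAv, hA, hbad⟩ := exists_badly_approximable_set hk hkd hΨ v hspan'
    (pos_iff_ne_zero.2 hs0) hsk (half_pos hr0)
  have hAb : A ⊆ ball v r := hAv.trans (closedBall_subset_ball (half_lt_self hr0))
  refine (hA.trans (dimH_le_dimH_image hc fun x hx y hy =>
    hexp x (hrr₂ (hAb hx)) y (hrr₂ (hAb hy)))).trans (dimH_mono ?_)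
  rintro _ ⟨a, ha, rfl⟩
  have haO : Ψ a ∈ O ∩ M := hOM ▸ mem_image_of_mem Ψ (hAb ha)
  obtain ⟨δ, hδ, hδO⟩ := Metric.isOpen_iff.1 hO _ haO.1
  obtain ⟨κ, hκ, hκa⟩ := hbad a ha
  refine mem_ofPred.2 ⟨haO.2, min (c * κ) δ, by positivity, fun q hq hqM => ?_⟩
  have hH : (1 : ℝ) ≤ ht q := by exact_mod_cast hq.ht_pos
  by_cases hqO : q ∈ O
  · obtain ⟨z, hz, rfl⟩ : q ∈ Ψ '' ball v r := hOM ▸ ⟨hqO, hqM⟩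
    rw [← dist_eq_norm]
    calc min (c * κ) δ * (ht (Ψ z) : ℝ) ^ (-ckd k d)
        ≤ c * κ * (ht (Ψ z) : ℝ) ^ (-ckd k d) := by
          gcongr
          exact min_le_left _ _
      _ = c * (κ * (ht (Ψ z) : ℝ) ^ (-ckd k d)) := mul_assoc _ _ _
      _ ≤ c * dist a z := by
          gcongr
          exact hκa z hq
      _ ≤ dist (Ψ a) (Ψ z) := hexp a (hrr₂ (hAb ha)) z (hrr₂ hz)
  · have h1 : δ ≤ dist q (Ψ a) := not_lt.1 fun h => hqO (hδO h)
    have h2 : (ht q : ℝ) ^ (-ckd k d) ≤ 1 :=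
      Real.rpow_le_one_of_one_le_of_nonpos hH (neg_nonpos.2 (ckd_pos hk hkd).le)
    rw [← dist_eq_norm, dist_comm]
    calc min (c * κ) δ * (ht q : ℝ) ^ (-ckd k d) ≤ δ * 1 := by
          gcongr
          exact min_le_right _ _
      _ ≤ dist q (Ψ a) := by rwa [mul_one]
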